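/- Let φ be a nonnegative function in L¹_loc(0,∞) with support contained in [0,1] and ∫₀^∞ φ(t) dt < ∞. Then H_φ is bounded on the real Hardy space H¹(ℝ) (with the norm ‖f‖ := ‖f‖_{L¹(ℝ)} + ‖H(f)‖_{L¹(ℝ)}) and its operator norm satisfies ∫₀^1 φ(t) dt ≤ ‖H_φ‖_{H¹(ℝ) → H¹(ℝ)} < ∞. -/

import Mathlib

open MeasureTheory Complex Filter Set Topology ENNReal NNReal

/-- The Hausdorff operator on functions on the real line:
`H_φ f (x) = ∫₀^∞ f(x/t) φ(t)/t dt`. -/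
noncomputable def hausdorffR (φ : ℝ → ℝ) (f : ℝ → ℂ) (x : ℝ) : ℂ :=
  ∫ t in Set.Ioi (0 : ℝ), (φ t / t) • f (x / t)

/-- The Hilbert transform `H f (x) = (1/π) p.v. ∫ f(y)/(x-y) dy`, defined as the
limit as `ε → 0⁺` of the truncated singular integrals. -/
noncomputable def hilbertT (f : ℝ → ℂ) (x : ℝ) : ℂ :=
  (Real.pi)⁻¹ • limUnder (𝓝[>] (0 : ℝ))
    (fun ε : ℝ => ∫ y in {y : ℝ | ε ≤ |x - y|}, f y / ((x : ℂ) - (y : ℂ)))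

/-- Membership in the real Hardy space `H¹(ℝ)`: `f ∈ L¹(ℝ)` with `H f ∈ L¹(ℝ)`. -/
def MemH1 (f : ℝ → ℂ) : Prop :=
  Integrable f volume ∧ Integrable (hilbertT f) volume

/-- The norm on the real Hardy space: `‖f‖ = ‖f‖_{L¹} + ‖H f‖_{L¹}`. -/
noncomputable def h1Norm (f : ℝ → ℂ) : ℝ≥0∞ :=
  eLpNorm f 1 volume + eLpNorm (hilbertT f) 1 volume


/-- Unnormalised Poisson kernel. -/
noncomputable def pk (y s : ℝ) : ℝ := y / (y ^ 2 + s ^ 2)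

lemma pk_nonneg {y : ℝ} (hy : 0 < y) (s : ℝ) : 0 ≤ pk y s := by unfold pk; positivity

lemma pk_cont {y : ℝ} (hy : 0 < y) : Continuous (pk y) := by
  unfold pk
  refine Continuous.div (by fun_prop) (by fun_prop) (fun s => by positivity)

lemma pk_meas (y : ℝ) : Measurable (pk y) := by unfold pk; fun_prop

lemma pk_eq {y : ℝ} (hy : 0 < y) (s : ℝ) : pk y s = y⁻¹ * (1 + (s / y) ^ 2)⁻¹ := by
  unfold pk; field_simp

lemma pk_integrable {y : ℝ} (hy : 0 < y) : Integrable (pk y) := by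
  have : pk y = fun s => y⁻¹ * (1 + (s / y) ^ 2)⁻¹ := funext (pk_eq hy)
  rw [this]
  exact (integrable_inv_one_add_sq.comp_div hy.ne').const_mul _

lemma pk_integral {y : ℝ} (hy : 0 < y) : ∫ s, pk y s = Real.pi := by
  have : pk y = fun s => y⁻¹ * (1 + (s / y) ^ 2)⁻¹ := funext (pk_eq hy)
  rw [this, integral_const_mul, Measure.integral_comp_div (fun s : ℝ => (1 + s ^ 2)⁻¹)]
  simp [abs_of_pos hy]
  field_simp

lemma pk_le_inv {y : ℝ} (hy : 0 < y) (s : ℝ) : pk y s ≤ y⁻¹ := by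
  rw [pk_eq hy]
  have : (1 + (s / y) ^ 2)⁻¹ ≤ 1 := inv_le_one_of_one_le₀ (by nlinarith [sq_nonneg (s / y)])
  have := mul_le_mul_of_nonneg_left this (inv_pos.2 hy).le
  simpa using this

/-- dyadic domination of the Poisson kernel -/
lemma pk_le_tsum {y : ℝ} (hy : 0 < y) (s : ℝ) :
    ENNReal.ofReal (pk y s) ≤ ∑' k : ℕ, ENNReal.ofReal (4 * (4⁻¹) ^ k / y) *
      (Metric.closedBall (0 : ℝ) (2 ^ k * y)).indicator 1 s := by
  have hex : ∃ k : ℕ, |s| ≤ 2 ^ k * y := by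
    obtain ⟨k, hk⟩ := pow_unbounded_of_one_lt (|s| / y) (one_lt_two)
    exact ⟨k, by rw [div_lt_iff₀ hy] at hk; exact hk.le⟩
  classical
  let k := Nat.find hex
  have hk : |s| ≤ 2 ^ k * y := Nat.find_spec hex
  refine le_trans ?_ (ENNReal.le_tsum k)
  rw [Set.indicator_of_mem (by simpa using hk)]
  simp only [Pi.one_apply, mul_one]
  apply ENNReal.ofReal_le_ofReal
  rcases Nat.eq_zero_or_pos k with h0 | h0
  · rw [h0]
    have := pk_le_inv hy s
    have h2 : 0 < y⁻¹ := inv_pos.2 hy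
    simp only [pow_zero, mul_one]
    rw [div_eq_mul_inv]; linarith
  · obtain ⟨m, hm⟩ := Nat.exists_eq_succ_of_ne_zero h0.ne'
    have hlt : ¬ |s| ≤ 2 ^ m * y := Nat.find_min hex (by change m < k; omega)
    push Not at hlt
    rw [hm]
    unfold pk
    have h2 : (2 ^ m * y) ^ 2 ≤ s ^ 2 := by
      rw [← sq_abs s]; gcongr
    have h4 : (4 : ℝ) ^ m = (2 ^ m) ^ 2 := by rw [← pow_mul, mul_comm, pow_mul]; norm_num
    calc y / (y ^ 2 + s ^ 2) ≤ y / (2 ^ m * y) ^ 2 := by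
          gcongr; nlinarith [sq_nonneg y]
      _ = _ := by
          rw [Nat.succ_eq_add_one, pow_succ (4⁻¹ : ℝ), inv_pow, h4]; field_simp

/-- near part -/
lemma near_bound {y r0 ε : ℝ} (hy : 0 < y) (hε : 0 ≤ ε) (x : ℝ) (g : ℝ → ℝ≥0∞) (hg : AEMeasurable g)
    (h : ∀ r, 0 < r → r ≤ r0 → ∫⁻ t in Metric.closedBall x r, g t ≤ ENNReal.ofReal (ε * r)) (hr0 : 0 < r0) :
    ∫⁻ t in Metric.closedBall x r0, ENNReal.ofReal (pk y (x - t)) * g t ≤ ENNReal.ofReal (8 * ε) := by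
  have h' : ∀ r, 0 < r → ∫⁻ t in Metric.closedBall x r0 ∩ Metric.closedBall x r, g t ≤ ENNReal.ofReal (ε * r) := by
    intro r hr
    rcases le_total r r0 with h1 | h1
    · exact (lintegral_mono_set inter_subset_right).trans (h r hr h1)
    · refine (lintegral_mono_set inter_subset_left).trans ((h r0 hr0 le_rfl).trans ?_)
      apply ENNReal.ofReal_le_ofReal; gcongr
  calc ∫⁻ t in Metric.closedBall x r0, ENNReal.ofReal (pk y (x - t)) * g t
      ≤ ∫⁻ t in Metric.closedBall x r0, ∑' k : ℕ, ENNReal.ofReal (4 * (4⁻¹) ^ k / y) *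
          (Metric.closedBall x (2 ^ k * y)).indicator g t := by
        apply lintegral_mono
        intro t
        refine (mul_le_mul_left (pk_le_tsum hy (x - t)) (g t)).trans ?_
        rw [← ENNReal.tsum_mul_right]
        apply ENNReal.tsum_le_tsum
        intro k
        rw [mul_assoc]
        gcongr
        by_cases hm : t ∈ Metric.closedBall x (2 ^ k * y)
        · have : x - t ∈ Metric.closedBall (0:ℝ) (2 ^ k * y) := by
            simpa [Real.dist_eq, abs_sub_comm] using hm
          simp [indicator_of_mem this, indicator_of_mem hm]
        · have : x - t ∉ Metric.closedBall (0:ℝ) (2 ^ k * y) := by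
            simpa [Real.dist_eq, abs_sub_comm] using hm
          simp [indicator_of_notMem this]
    _ = ∑' k : ℕ, ENNReal.ofReal (4 * (4⁻¹) ^ k / y) *
          ∫⁻ t in Metric.closedBall x r0 ∩ Metric.closedBall x (2 ^ k * y), g t := by
        rw [lintegral_tsum]
        · congr 1; ext k
          rw [lintegral_const_mul' _ _ ENNReal.ofReal_ne_top, lintegral_indicator Metric.isClosed_closedBall.measurableSet,
            Measure.restrict_restrict Metric.isClosed_closedBall.measurableSet, inter_comm]
        · intro k
          exact ((hg.restrict.indicator Metric.isClosed_closedBall.measurableSet).const_mul _)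
    _ ≤ ∑' k : ℕ, ENNReal.ofReal (4 * ε * (2⁻¹) ^ k) := by
        apply ENNReal.tsum_le_tsum
        intro k
        refine (mul_le_mul_right (h' (2 ^ k * y) (by positivity)) _).trans ?_
        rw [← ENNReal.ofReal_mul (by positivity)]
        apply ENNReal.ofReal_le_ofReal
        have h4 : (4 : ℝ) ^ k = (2 ^ k) ^ 2 := by rw [← pow_mul, mul_comm, pow_mul]; norm_num
        rw [inv_pow, inv_pow, h4]
        apply le_of_eq; field_simp
    _ = ENNReal.ofReal (8 * ε) := by
        rw [← ENNReal.ofReal_tsum_of_nonneg]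
        · have h2 := (hasSum_geometric_of_lt_one (r := (2⁻¹ : ℝ)) (by norm_num) (by norm_num)).mul_left (4 * ε)
          rw [h2.tsum_eq]; congr 1; norm_num; ring
        · intro k; positivity
        · exact (summable_geometric_of_lt_one (by norm_num) (by norm_num)).mul_left _

lemma far_const {x r0 : ℝ} (hr0 : 0 < r0) {t : ℝ} (ht : r0 ≤ |x - t|) :
    1 + t ^ 2 ≤ ((1 + 2 * x ^ 2) / r0 ^ 2 + 2) * (x - t) ^ 2 := by
  have h1 : r0 ^ 2 ≤ (x - t) ^ 2 := by rw [← sq_abs (x - t)]; gcongr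
  have h2 : (1 + 2 * x ^ 2) ≤ (1 + 2 * x ^ 2) / r0 ^ 2 * (x - t) ^ 2 := by
    rw [div_mul_eq_mul_div, le_div_iff₀ (by positivity)]
    gcongr
  nlinarith [sq_nonneg (2 * x - t)]

lemma far_bound {x r0 y : ℝ} (hr0 : 0 < r0) (hy : 0 < y) {t : ℝ} (ht : r0 ≤ |x - t|) :
    pk y (x - t) ≤ y * ((1 + 2 * x ^ 2) / r0 ^ 2 + 2) * (1 + t ^ 2)⁻¹ := by
  have h := far_const (x := x) hr0 ht
  have h1 : 0 < (x - t) ^ 2 := by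
    have : 0 < |x - t| := hr0.trans_le ht
    rw [← sq_abs]; positivity
  unfold pk
  rw [div_le_iff₀ (by positivity), mul_assoc, mul_assoc]
  refine le_mul_of_one_le_right hy.le ?_
  rw [← mul_assoc, mul_comm _ (1 + t ^ 2)⁻¹, mul_assoc, ← div_eq_inv_mul, le_div_iff₀ (by positivity), one_mul]
  refine h.trans ?_
  gcongr; nlinarith [sq_nonneg y]

lemma locInt_of_weight {b : ℝ → ℂ} (hb : Integrable (fun t : ℝ => ((1 + t ^ 2)⁻¹ : ℝ) • b t)) :
    LocallyIntegrable b := by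
  have h := hb.locallyIntegrable
  have h2 : b = fun t : ℝ => ((1 + t ^ 2) : ℝ) • (((1 + t ^ 2)⁻¹ : ℝ) • b t) := by
    ext t; rw [smul_smul, mul_inv_cancel₀ (by positivity), one_smul]
  rw [h2]
  rw [← locallyIntegrableOn_univ] at h ⊢
  exact h.continuousOn_smul isOpen_univ.isLocallyClosed (by fun_prop)

theorem approx_id {b : ℝ → ℂ} (hb : Integrable (fun t : ℝ => ((1 + t ^ 2)⁻¹ : ℝ) • b t)) :
    ∀ᵐ x : ℝ, Tendsto (fun y => ∫⁻ t, ENNReal.ofReal (pk y (x - t)) * ‖b t - b x‖ₑ) (𝓝[>] 0) (𝓝 0) := by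
  have hloc := locInt_of_weight hb
  filter_upwards [IsUnifLocDoublingMeasure.ae_tendsto_average_norm_sub volume hloc 1] with x hx
  have hx' := hx (l := 𝓝[>] (0:ℝ)) (fun _ => x) id tendsto_id (by
    filter_upwards [self_mem_nhdsWithin] with r hr
    simpa using (le_of_lt hr))
  have hgm : AEMeasurable (fun t => ‖b t - b x‖ₑ) :=
    (hloc.aestronglyMeasurable.sub aestronglyMeasurable_const).enorm
  set W := ∫⁻ t, ENNReal.ofReal ((1 + t ^ 2)⁻¹) * ‖b t - b x‖ₑ with hW
  have hWfin : W ≠ ⊤ := by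
    have h1 : Integrable (fun t : ℝ => ((1 + t ^ 2)⁻¹ : ℝ) • (b t - b x)) := by
      simp_rw [smul_sub]
      exact hb.sub (integrable_inv_one_add_sq.smul_const _)
    have := h1.2.ne
    rw [hW]
    convert! this using 4 with t
    rw [enorm_smul, Real.enorm_eq_ofReal (by positivity)]
  rw [ENNReal.tendsto_nhds_zero]
  intro ε hε
  by_cases hεt : ε = ⊤
  · simp [hεt]
  obtain ⟨e, he, rfl⟩ : ∃ e : ℝ, 0 < e ∧ ε = ENNReal.ofReal e :=
    ⟨ε.toReal, ENNReal.toReal_pos hε.ne' hεt, (ENNReal.ofReal_toReal hεt).symm⟩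
  have hnear := hx'.eventually (gt_mem_nhds (show (0:ℝ) < e / 32 by positivity))
  rw [eventually_nhdsWithin_iff, Metric.eventually_nhds_iff] at hnear
  obtain ⟨r1, hr1, hnear⟩ := hnear
  set r0 := r1 / 2 with hr0d
  have hr0 : 0 < r0 := by positivity
  have hball : ∀ r, 0 < r → r ≤ r0 → ∫⁻ t in Metric.closedBall x r, ‖b t - b x‖ₑ ≤ ENNReal.ofReal (e / 16 * r) := by
    intro r hr hrr
    have h1 := hnear (y := r) (by rw [Real.dist_eq, sub_zero, abs_of_pos hr]; linarith) hr
    have hint : IntegrableOn (fun t => b t - b x) (Metric.closedBall x r) :=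
      (hloc.integrableOn_isCompact (isCompact_closedBall x r)).sub
        ((continuous_const.locallyIntegrable).integrableOn_isCompact (isCompact_closedBall x r))
    rw [← ofReal_integral_norm_eq_lintegral_enorm hint]
    apply ENNReal.ofReal_le_ofReal
    rw [setAverage_eq] at h1
    simp only [id, smul_eq_mul] at h1
    rw [Real.volume_real_closedBall hr.le, ← div_eq_inv_mul, div_lt_iff₀ (by positivity)] at h1
    linarith
  set K := (1 + 2 * x ^ 2) / r0 ^ 2 + 2 with hK
  have hfar : ∀ᶠ y in 𝓝[>] (0:ℝ), ENNReal.ofReal (y * K) * W ≤ ENNReal.ofReal (e / 2) := by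
    have : Tendsto (fun y : ℝ => ENNReal.ofReal (y * K) * W) (𝓝[>] 0) (𝓝 (ENNReal.ofReal (0 * K) * W)) := by
      refine ENNReal.Tendsto.mul_const ?_ (Or.inr hWfin)
      refine ENNReal.tendsto_ofReal ?_
      exact ((continuous_id.mul continuous_const).tendsto 0).mono_left nhdsWithin_le_nhds
    simp only [zero_mul, ENNReal.ofReal_zero] at this
    exact (this.eventually (gt_mem_nhds (show 0 < ENNReal.ofReal (e/2) by simp [he]))).mono fun _ h => h.le
  filter_upwards [hfar, self_mem_nhdsWithin] with y hy hy0
  have hy0 : 0 < y := hy0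
  rw [← lintegral_add_compl _ (Metric.isClosed_closedBall (x := x) (ε := r0)).measurableSet]
  have hn := near_bound hy0 (by positivity) x _ hgm hball hr0
  have hf : ∫⁻ t in (Metric.closedBall x r0)ᶜ, ENNReal.ofReal (pk y (x - t)) * ‖b t - b x‖ₑ ≤ ENNReal.ofReal (y * K) * W := by
    calc _ ≤ ∫⁻ t in (Metric.closedBall x r0)ᶜ, ENNReal.ofReal (y * K) * (ENNReal.ofReal ((1 + t ^ 2)⁻¹) * ‖b t - b x‖ₑ) := by
          apply setLIntegral_mono' Metric.isClosed_closedBall.measurableSet.compl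
          intro t ht
          rw [← mul_assoc, ← ENNReal.ofReal_mul (by positivity)]
          gcongr
          apply far_bound hr0 hy0
          simp [Real.dist_eq, abs_sub_comm] at ht
          exact ht.le
      _ ≤ ∫⁻ t, ENNReal.ofReal (y * K) * (ENNReal.ofReal ((1 + t ^ 2)⁻¹) * ‖b t - b x‖ₑ) := setLIntegral_le_lintegral _ _
      _ = _ := lintegral_const_mul' _ _ ENNReal.ofReal_ne_top
  calc _ ≤ ENNReal.ofReal (8 * (e/16)) + ENNReal.ofReal (e/2) := add_le_add hn (hf.trans hy)
    _ = ENNReal.ofReal e := by rw [← ENNReal.ofReal_add (by positivity) (by positivity)]; ring_nf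

lemma contour {D : ℂ → ℂ} (hD : DifferentiableOn ℂ D {w | 0 ≤ w.im}) (C R0 : ℝ)
    (hC : ∀ w : ℂ, 0 ≤ w.im → R0 ≤ ‖w‖ → ‖D w‖ ≤ C / ‖w‖ ^ 2) :
    Tendsto (fun R : ℝ => ∫ t in (-R)..R, D t) atTop (𝓝 0) := by
  have hlim : Tendsto (fun R : ℝ => 4 * |C| / R) atTop (𝓝 0) := tendsto_const_nhds.div_atTop tendsto_id
  refine squeeze_zero_norm' ?_ hlim
  filter_upwards [eventually_ge_atTop (max R0 1)] with R hR
  have hR0 : R0 ≤ R := (le_max_left _ _).trans hR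
  have hR1 : 1 ≤ R := (le_max_right _ _).trans hR
  have hRpos : 0 < R := by linarith
  have hb : ∀ w : ℂ, 0 ≤ w.im → R ≤ ‖w‖ → ‖D w‖ ≤ |C| / R ^ 2 := by
    intro w hw hRw
    refine (hC w hw (hR0.trans hRw)).trans ?_
    have : C ≤ |C| := le_abs_self C
    gcongr
  have key := Complex.integral_boundary_rect_eq_zero_of_differentiableOn D (-R : ℝ) (R + R * I : ℂ) (by
    apply hD.mono
    intro w hw
    have := hw.2
    simp [uIcc_of_le hRpos.le] at this
    exact this.1)
  simp at key
  have h1 : ‖∫ x in (-R)..R, D (x + R * I)‖ ≤ |C| / R ^ 2 * |R - -R| := by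
    apply intervalIntegral.norm_integral_le_of_norm_le_const
    intro x _
    apply hb _ (by simp [hRpos.le])
    have := abs_im_le_norm (x + R * I : ℂ)
    simp [abs_of_pos hRpos] at this
    exact this
  have h2 : ‖∫ y in (0:ℝ)..R, D (R + y * I)‖ ≤ |C| / R ^ 2 * |R - 0| := by
    apply intervalIntegral.norm_integral_le_of_norm_le_const
    intro y hy
    rw [uIoc_of_le hRpos.le] at hy
    apply hb _ (by simp [hy.1.le])
    have := abs_re_le_norm (R + y * I : ℂ)
    simp [abs_of_pos hRpos] at this
    exact this
  have h3 : ‖∫ y in (0:ℝ)..R, D (-R + y * I)‖ ≤ |C| / R ^ 2 * |R - 0| := by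
    apply intervalIntegral.norm_integral_le_of_norm_le_const
    intro y hy
    rw [uIoc_of_le hRpos.le] at hy
    apply hb _ (by simp [hy.1.le])
    have := abs_re_le_norm (-R + y * I : ℂ)
    simp [abs_of_pos hRpos] at this
    exact this
  have h4 : ∫ t in (-R)..R, D t = (∫ x in (-R)..R, D (x + R * I)) - I * (∫ y in (0:ℝ)..R, D (R + y * I))
      + I * (∫ y in (0:ℝ)..R, D (-R + y * I)) := by
    linear_combination key
  rw [h4]
  refine (norm_add_le _ _).trans ?_
  refine (add_le_add (norm_sub_le _ _) le_rfl).trans ?_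
  rw [norm_mul, norm_mul, norm_I, one_mul, one_mul]
  refine (add_le_add (add_le_add h1 h2) h3).trans (le_of_eq ?_)
  rw [sub_neg_eq_add, sub_zero, abs_of_pos hRpos, abs_of_pos (show 0 < R + R by linarith)]
  field_simp; ring

lemma contour' {D : ℂ → ℂ} (hD : DifferentiableOn ℂ D {w | 0 ≤ w.im}) (C R0 : ℝ)
    (hC : ∀ w : ℂ, 0 ≤ w.im → R0 ≤ ‖w‖ → ‖D w‖ ≤ C / ‖w‖ ^ 2) (hi : Integrable (fun t : ℝ => D t)) :
    ∫ t : ℝ, D t = 0 :=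
  tendsto_nhds_unique (intervalIntegral_tendsto_integral hi tendsto_neg_atTop_atBot tendsto_id)
    (contour hD C R0 hC)

lemma pk_sub_integrable {y : ℝ} (hy : 0 < y) (x : ℝ) : Integrable (fun t => pk y (x - t)) :=
  (pk_integrable hy).comp_sub_left x

lemma pk_sub_integral {y : ℝ} (hy : 0 < y) (x : ℝ) : ∫ t, pk y (x - t) = Real.pi := by
  rw [integral_sub_left_eq_self (pk y), pk_integral hy]

lemma cont_real {B : ℂ → ℂ} (hB : DifferentiableOn ℂ B {w | 0 ≤ w.im}) : Continuous (fun t : ℝ => B t) :=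
  hB.continuousOn.comp_continuous continuous_ofReal (fun t => by simp)

theorem poisson_rep {B : ℂ → ℂ} {M : ℝ} (hB : DifferentiableOn ℂ B {w | 0 ≤ w.im})
    (hM : ∀ w : ℂ, 0 ≤ w.im → ‖B w‖ ≤ M) (x : ℝ) {y : ℝ} (hy : 0 < y) :
    ∫ t : ℝ, (pk y (x - t)) • B t = Real.pi • B (x + y * I) := by
  set z : ℂ := x + y * I with hz
  have hzim : z.im = y := by simp [hz]
  have hM0 : 0 ≤ M := (norm_nonneg _).trans (hM 0 (by simp))
  have hnh : {w : ℂ | 0 ≤ w.im} ∈ 𝓝 z := by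
    have : {w : ℂ | 0 < w.im} ∈ 𝓝 z := (isOpen_lt continuous_const continuous_im).mem_nhds (by simp [hzim, hy])
    filter_upwards [this] with w hw using le_of_lt hw
  set zc : ℂ := x - y * I with hzc
  have hne : ∀ w : ℂ, 0 ≤ w.im → w - zc ≠ 0 := by
    intro w hw h
    have := congrArg Complex.im h
    simp [hzc] at this; linarith
  set D : ℂ → ℂ := fun w => dslope B z w * (w - zc)⁻¹ with hDdef
  have hD : DifferentiableOn ℂ D {w | 0 ≤ w.im} := by
    apply DifferentiableOn.mul ((Complex.differentiableOn_dslope hnh).2 hB)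
    exact DifferentiableOn.inv (by fun_prop) hne
  have hDt : ∀ t : ℝ, D t = (y⁻¹ * pk y (x - t) : ℝ) • (B t - B z) := by
    intro t
    have h1 : (t : ℂ) ≠ z := by
      intro h; have := congrArg Complex.im h; rw [hzim] at this; simp at this; linarith
    have h2 := hne t (by simp)
    simp only [hDdef]
    rw [dslope_of_ne _ h1, slope_def_field]
    have h3 : ((y⁻¹ * pk y (x - t) : ℝ) : ℂ) = ((t - z) * (t - zc))⁻¹ := by
      have h5 : ((t:ℂ) - z) * (t - zc) = ((y ^ 2 + (x - t) ^ 2 : ℝ) : ℂ) := by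
        rw [hz, hzc]; push_cast; linear_combination (-(y:ℂ)^2) * I_sq
      have h6 : y⁻¹ * pk y (x - t) = (y ^ 2 + (x - t) ^ 2)⁻¹ := by
        unfold pk; field_simp
      rw [h5, h6, ofReal_inv]
    rw [real_smul, h3, mul_inv]
    ring
  have hi1 : Integrable (fun t : ℝ => pk y (x - t) • B t) := by
    refine (pk_sub_integrable hy x).smul_of_top_left (memLp_top_of_bound (cont_real hB).aestronglyMeasurable M ?_)
    exact ae_of_all _ fun t => hM t (by simp)
  have hi2 : Integrable (fun t : ℝ => pk y (x - t) • B z) := (pk_sub_integrable hy x).smul_const _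
  have hDt' : (fun t : ℝ => D t) = fun t : ℝ => y⁻¹ • (pk y (x - t) • B t - pk y (x - t) • B z) := by
    ext t; rw [hDt, mul_smul, smul_sub]
  have h0 := contour' hD (8 * M) (2 * ‖z‖ + 1) (by
    intro w hw hwR
    have hw1 : 0 < ‖w‖ := by have := norm_nonneg z; linarith
    have hnz : ‖zc‖ = ‖z‖ := by
      have : zc = (starRingEnd ℂ) z := by simp [hz, hzc, sub_eq_add_neg]
      rw [this, Complex.norm_conj]
    have e1 : ‖w‖ / 2 ≤ ‖w - z‖ := by have := norm_sub_norm_le w z; linarith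
    have e2 : ‖w‖ / 2 ≤ ‖w - zc‖ := by have := norm_sub_norm_le w zc; rw [hnz] at this; linarith
    have h1 : w ≠ z := by rintro rfl; simp at e1; linarith [norm_pos_iff.1 hw1, hw1]
    simp only [hDdef]
    rw [dslope_of_ne _ h1, slope_def_field, norm_mul, norm_div, norm_inv]
    have e3 : ‖B w - B z‖ ≤ 2 * M := (norm_sub_le _ _).trans (by linarith [hM w hw, hM z (by rw [hzim]; exact hy.le)])
    calc ‖B w - B z‖ / ‖w - z‖ * ‖w - zc‖⁻¹ ≤ (2 * M) / (‖w‖ / 2) * (‖w‖ / 2)⁻¹ := by gcongr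
      _ = _ := by field_simp; ring) (by
    rw [hDt']; exact Integrable.smul (y⁻¹) (hi1.sub hi2))
  rw [hDt', integral_smul, integral_sub hi1 hi2, integral_smul_const, pk_sub_integral hy] at h0
  rcases smul_eq_zero.1 h0 with h | h
  · exact absurd h (inv_pos.2 hy).ne'
  · exact sub_eq_zero.1 h

lemma pk_weight {y : ℝ} (hy : 0 < y) (x t : ℝ) :
    pk y (x - t) * (1 + t ^ 2) ≤ (1 + 2 * x ^ 2) / y + 2 * y := by
  unfold pk
  rw [div_mul_eq_mul_div, div_le_iff₀ (by positivity)]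
  have h : 1 + t ^ 2 ≤ (1 + 2 * x ^ 2) + 2 * (x - t) ^ 2 := by nlinarith [sq_nonneg (2 * x - t)]
  have h2 : ((1 + 2 * x ^ 2) / y + 2 * y) * (y ^ 2 + (x - t) ^ 2) =
      y * ((1 + 2 * x ^ 2) + 2 * (x - t) ^ 2) + (1 + 2 * x ^ 2) / y * (x - t) ^ 2 + 2 * y ^ 3 := by
    field_simp; ring
  rw [h2]
  have h3 : 0 ≤ (1 + 2 * x ^ 2) / y * (x - t) ^ 2 := by positivity
  have h4 : 0 < y ^ 3 := by positivity
  have := mul_le_mul_of_nonneg_left h hy.le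
  linarith

lemma weight_of_integrable {f : ℝ → ℂ} (hf : Integrable f) :
    Integrable (fun t : ℝ => ((1 + t ^ 2)⁻¹ : ℝ) • f t) := by
  refine hf.bdd_smul (φ := fun t : ℝ => ((1 + t ^ 2)⁻¹ : ℝ)) 1 ?_ ?_
  · exact Measurable.aestronglyMeasurable (by fun_prop)
  · refine ae_of_all _ fun t => ?_
    rw [Real.norm_eq_abs, abs_of_nonneg (by positivity)]
    exact inv_le_one_of_one_le₀ (by nlinarith [sq_nonneg t])

lemma kernel_integrable {b : ℝ → ℂ} (hb : Integrable (fun t : ℝ => ((1 + t ^ 2)⁻¹ : ℝ) • b t))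
    {K : ℝ → ℝ} (hKm : Measurable K) {c y : ℝ} (hy : 0 < y) (hc : 0 ≤ c) (hK : ∀ s, |K s| ≤ c * pk y s) (x : ℝ) :
    Integrable (fun t : ℝ => K (x - t) • b t) := by
  have h := hb.bdd_smul (φ := fun t : ℝ => K (x - t) * (1 + t ^ 2)) (c * ((1 + 2 * x ^ 2) / y + 2 * y))
    (Measurable.aestronglyMeasurable (by fun_prop)) (ae_of_all _ fun t => by
      rw [norm_mul, Real.norm_eq_abs, Real.norm_eq_abs, abs_of_pos (show 0 < 1 + t ^ 2 by positivity)]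
      calc _ ≤ c * pk y (x - t) * (1 + t ^ 2) := by gcongr; exact hK _
        _ ≤ _ := by rw [mul_assoc]; gcongr; exact pk_weight hy x t)
  convert! h using 1
  ext t
  simp only [Pi.smul_apply', smul_smul]
  rw [mul_assoc, mul_inv_cancel₀ (by positivity), mul_one]

lemma pk_smul_integrable {b : ℝ → ℂ} (hb : Integrable (fun t : ℝ => ((1 + t ^ 2)⁻¹ : ℝ) • b t))
    {y : ℝ} (hy : 0 < y) (x : ℝ) : Integrable (fun t : ℝ => pk y (x - t) • b t) :=
  kernel_integrable hb (pk_meas y) hy zero_le_one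
    (fun s => by rw [one_mul, abs_of_nonneg (pk_nonneg hy s)]) x

theorem kernel_ae {b : ℝ → ℂ} (hb : Integrable (fun t : ℝ => ((1 + t ^ 2)⁻¹ : ℝ) • b t)) :
    ∀ᵐ x : ℝ, ∀ (K : ℝ → ℝ → ℝ) (c κ : ℝ), (∀ y, Measurable (K y)) → 0 ≤ c →
      (∀ y, 0 < y → ∀ s, |K y s| ≤ c * pk y s) → (∀ y, 0 < y → ∫ s, K y s = κ) →
      Tendsto (fun y => ∫ t, K y (x - t) • b t) (𝓝[>] 0) (𝓝 (κ • b x)) := by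
  filter_upwards [approx_id hb] with x hx K c κ hKm hc hK hκ
  have h0 : Tendsto (fun y => (ENNReal.ofReal c * ∫⁻ t, ENNReal.ofReal (pk y (x - t)) * ‖b t - b x‖ₑ).toReal)
      (𝓝[>] 0) (𝓝 0) := by
    have h1 := ENNReal.Tendsto.const_mul (a := ENNReal.ofReal c) hx (Or.inr ENNReal.ofReal_ne_top)
    rw [mul_zero] at h1
    exact (ENNReal.tendsto_toReal ENNReal.zero_ne_top).comp h1
  have hfin : ∀ᶠ y in 𝓝[>] (0:ℝ), (∫⁻ t, ENNReal.ofReal (pk y (x - t)) * ‖b t - b x‖ₑ) < ⊤ :=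
    hx.eventually (gt_mem_nhds ENNReal.zero_lt_top)
  rw [tendsto_iff_norm_sub_tendsto_zero]
  refine squeeze_zero' (Eventually.of_forall fun _ => norm_nonneg _) ?_ h0
  filter_upwards [hfin, self_mem_nhdsWithin] with y hyf hy
  have hy : 0 < y := hy
  have hKi : Integrable (fun t => K y (x - t)) := by
    refine Integrable.mono' ((pk_sub_integrable hy x).const_mul c) ?_ (ae_of_all _ fun t => hK y hy _)
    exact ((hKm y).comp (measurable_const.sub measurable_id)).aestronglyMeasurable
  have hKint : ∫ t, K y (x - t) = κ := by rw [integral_sub_left_eq_self (K y), hκ y hy]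
  have e1 : (∫ t, K y (x - t) • b t) - κ • b x = ∫ t, K y (x - t) • (b t - b x) := by
    simp_rw [smul_sub]
    rw [integral_sub (kernel_integrable hb (hKm y) hy hc (hK y hy) x) (hKi.smul_const _), integral_smul_const, hKint]
  rw [e1, ← toReal_enorm]
  apply ENNReal.toReal_mono (ENNReal.mul_ne_top ENNReal.ofReal_ne_top hyf.ne)
  refine (enorm_integral_le_lintegral_enorm _).trans ?_
  rw [← lintegral_const_mul' _ _ ENNReal.ofReal_ne_top]
  apply lintegral_mono
  intro t
  beta_reduce
  rw [enorm_smul, ← mul_assoc, ← ENNReal.ofReal_mul hc]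
  gcongr
  rw [← ofReal_norm]
  exact ENNReal.ofReal_le_ofReal (hK y hy _)

theorem poisson_ae {b : ℝ → ℂ} (hb : Integrable (fun t : ℝ => ((1 + t ^ 2)⁻¹ : ℝ) • b t)) :
    ∀ᵐ x : ℝ, Tendsto (fun y => ∫ t, pk y (x - t) • b t) (𝓝[>] 0) (𝓝 (Real.pi • b x)) := by
  filter_upwards [kernel_ae hb] with x hx
  exact hx pk 1 Real.pi pk_meas zero_le_one
    (fun y hy s => by rw [one_mul, abs_of_nonneg (pk_nonneg hy s)]) (fun y hy => pk_integral hy)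

lemma norm_add_I_sq (t : ℝ) : ‖(t + I : ℂ)‖ ^ 2 = 1 + t ^ 2 := by
  rw [Complex.sq_norm, Complex.normSq_apply]; simp; ring

lemma add_I_ne (t : ℝ) : (t + I : ℂ) ≠ 0 := by
  intro h; have := congrArg Complex.im h; simp at this

lemma memLp_w : MemLp (fun t : ℝ => ((t + I : ℂ))⁻¹) 2 volume := by
  rw [memLp_two_iff_integrable_sq_norm]
  · simp_rw [norm_inv, inv_pow, norm_add_I_sq]
    exact integrable_inv_one_add_sq
  · apply Continuous.aestronglyMeasurable
    exact Continuous.inv₀ (by fun_prop) add_I_ne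

lemma memLp_test {y : ℝ} (hy : 0 < y) (x : ℝ) :
    MemLp (fun t : ℝ => (pk y (x - t) : ℂ) * (t - I)) 2 volume := by
  have hc : Continuous (fun t => pk y (x - t)) := (pk_cont hy).comp (by fun_prop)
  rw [memLp_two_iff_integrable_sq_norm (by apply Continuous.aestronglyMeasurable; fun_prop)]
  refine Integrable.mono' ((pk_sub_integrable hy x).const_mul ((1 + 2 * x ^ 2) / y + 2 * y)) ?_ ?_
  · apply Continuous.aestronglyMeasurable; fun_prop
  · refine ae_of_all _ fun t => ?_
    have h1 : ‖(t - I : ℂ)‖ ^ 2 = 1 + t ^ 2 := by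
      rw [Complex.sq_norm, Complex.normSq_apply]; simp; ring
    rw [Real.norm_eq_abs, abs_of_nonneg (by positivity), norm_mul, mul_pow, h1, Complex.norm_real, Real.norm_eq_abs, sq_abs]
    have := mul_le_mul_of_nonneg_left (pk_weight hy x t) (pk_nonneg hy (x - t))
    nlinarith

/-- The Fatou theorem for bounded analytic functions on the upper half plane. -/
theorem fatou {B : ℂ → ℂ} {M : ℝ} (hB : DifferentiableOn ℂ B {w | 0 < w.im})
    (hM : ∀ w : ℂ, 0 < w.im → ‖B w‖ ≤ M) :
    ∃ b : ℝ → ℂ, Integrable (fun t : ℝ => ((1 + t ^ 2)⁻¹ : ℝ) • b t) ∧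
      (∀ x y : ℝ, 0 < y → ∫ t : ℝ, (pk y (x - t)) • b t = Real.pi • B (x + y * I)) ∧
      (∀ᵐ x : ℝ, Tendsto (fun y : ℝ => B (x + y * I)) (𝓝[>] 0) (𝓝 (b x))) := by
  have hM0 : 0 ≤ M := (norm_nonneg _).trans (hM I (by simp))
  have hopen : IsOpen {w : ℂ | 0 < w.im} := isOpen_lt continuous_const continuous_im
  have hsh : ∀ δ : ℝ, 0 < δ → DifferentiableOn ℂ (fun w => B (w + δ * I)) {w | 0 ≤ w.im} := by
    intro δ hδ
    refine hB.comp (by fun_prop) ?_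
    intro w hw
    simp at hw ⊢; linarith
  have hmem : ∀ δ : ℝ, 0 < δ → MemLp (fun t : ℝ => B (t + δ * I) * ((t + I : ℂ))⁻¹) 2 volume := by
    intro δ hδ
    refine memLp_w.of_le_mul (c := M) ?_ (ae_of_all _ fun t => ?_)
    · exact ((cont_real (hsh δ hδ)).mul (Continuous.inv₀ (by fun_prop) add_I_ne)).aestronglyMeasurable
    · rw [norm_mul]; gcongr; exact hM _ (by simp [hδ])
  classical
  let u : ℝ → Lp ℂ 2 (volume : Measure ℝ) := fun δ => if h : 0 < δ then (hmem δ h).toLp _ else 0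
  set R := M * ‖memLp_w.toLp _‖ with hR
  have hu : ∀ δ, ‖u δ‖ ≤ R := by
    intro δ
    by_cases h : 0 < δ
    · simp only [u, dif_pos h]
      apply Lp.norm_le_mul_norm_of_ae_le_mul
      filter_upwards [(hmem δ h).coeFn_toLp, memLp_w.coeFn_toLp] with t h1 h2
      rw [h1, h2, norm_mul]; gcongr; exact hM _ (by simp [h])
    · simp only [u, dif_neg h, norm_zero]; positivity
  let ℓ : ℝ → WeakDual ℂ (Lp ℂ 2 (volume : Measure ℝ)) := fun δ =>
    StrongDual.toWeakDual (InnerProductSpace.toDual ℂ _ (u δ))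
  let U : Ultrafilter ℝ := Ultrafilter.of (𝓝[>] (0:ℝ))
  have hU : (U : Filter ℝ) ≤ 𝓝[>] (0:ℝ) := Ultrafilter.of_le _
  have hcomp := WeakDual.isCompact_closedBall (0 : StrongDual ℂ (Lp ℂ 2 (volume : Measure ℝ))) R
  obtain ⟨L, -, hL⟩ := hcomp.ultrafilter_le_nhds (U.map ℓ) (by
    rw [le_principal_iff, Ultrafilter.mem_coe, Ultrafilter.mem_map]
    refine Filter.mem_of_superset (Filter.univ_mem) ?_
    intro δ _
    simp [ℓ]
    exact hu δ)
  let v : Lp ℂ 2 (volume : Measure ℝ) := (InnerProductSpace.toDual ℂ _).symm (WeakDual.toStrongDual L)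
  have hlim : ∀ g : Lp ℂ 2 (volume : Measure ℝ), Tendsto (fun δ => inner ℂ g (u δ)) U (𝓝 (inner ℂ g v)) := by
    intro g
    have h1 : Tendsto (fun δ => ℓ δ g) U (𝓝 (L g)) :=
      ((WeakDual.eval_continuous g).tendsto L).comp hL
    have h2 : L g = inner ℂ v g := by
      have : InnerProductSpace.toDual ℂ _ v = WeakDual.toStrongDual L := LinearIsometryEquiv.apply_symm_apply _ _
      rw [← InnerProductSpace.toDual_apply_apply, this]; rfl
    rw [h2] at h1
    have h3 := (Complex.continuous_conj.tendsto _).comp h1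
    rw [inner_conj_symm] at h3
    refine h3.congr fun δ => ?_
    simp only [Function.comp]
    rw [← inner_conj_symm g (u δ)]; rfl
  have hbw : Integrable (fun t : ℝ => ((1 + t ^ 2)⁻¹ : ℝ) • ((v t : ℂ) * (t + I))) := by
    have h1 := (Lp.memLp v).integrable_mul (memLp_w.star)
    convert! h1 using 1
    ext t
    simp only [Pi.mul_apply, Pi.star_apply]
    rw [← norm_add_I_sq, real_smul]
    have h2 : (star ((t + I : ℂ)⁻¹)) = ((‖(t + I : ℂ)‖ ^ 2 : ℝ) : ℂ)⁻¹ * (t + I) := by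
      rw [← Complex.normSq_eq_norm_sq, Complex.star_def, map_inv₀, Complex.inv_def, Complex.normSq_conj, Complex.conj_conj]
      simp [mul_comm]
    rw [h2]; push_cast; ring
  have hrep : ∀ x y : ℝ, 0 < y → ∫ t : ℝ, (pk y (x - t)) • ((v t : ℂ) * (t + I)) = Real.pi • B (x + y * I) := by
    intro x y hy
    have hin : ∀ w : Lp ℂ 2 (volume : Measure ℝ), inner ℂ ((memLp_test hy x).toLp _) w =
        ∫ t : ℝ, (pk y (x - t)) • ((w t : ℂ) * (t + I)) := by
      intro w
      rw [L2.inner_def]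
      apply integral_congr_ae
      filter_upwards [(memLp_test hy x).coeFn_toLp] with t ht
      rw [ht]
      simp
      ring
    have h1 := hlim ((memLp_test hy x).toLp _)
    rw [hin] at h1
    have h2 : Tendsto (fun δ : ℝ => Real.pi • B (x + y * I + δ * I)) (𝓝[>] 0) (𝓝 (Real.pi • B (x + y * I))) := by
      refine Tendsto.const_smul ?_ _
      have hc : ContinuousAt B (x + y * I) :=
        (hB.differentiableAt (hopen.mem_nhds (by simp [hy]))).continuousAt
      have : Tendsto (fun δ : ℝ => (x + y * I + δ * I : ℂ)) (𝓝[>] 0) (𝓝 (x + y * I)) := by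
        have h3 : Continuous (fun δ : ℝ => (x + y * I + δ * I : ℂ)) := by fun_prop
        simpa using (h3.tendsto 0).mono_left nhdsWithin_le_nhds
      exact hc.tendsto.comp this
    refine tendsto_nhds_unique h1 ((h2.mono_left hU).congr' ?_)
    filter_upwards [hU self_mem_nhdsWithin] with δ hδ
    have hδ : 0 < δ := hδ
    rw [hin, ← poisson_rep (hsh δ hδ) (M := M) (fun w hw => hM _ (by simp; linarith)) x hy]
    apply integral_congr_ae
    simp only [u, dif_pos hδ]
    filter_upwards [(hmem δ hδ).coeFn_toLp] with t ht
    rw [ht, inv_mul_cancel_right₀ (add_I_ne t)]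
  refine ⟨fun t => (v t : ℂ) * (t + I), hbw, hrep, ?_⟩
  filter_upwards [poisson_ae hbw] with x hx
  have h1 := hx.const_smul (Real.pi⁻¹)
  rw [smul_smul, inv_mul_cancel₀ Real.pi_ne_zero, one_smul] at h1
  refine h1.congr' ?_
  filter_upwards [self_mem_nhdsWithin] with y hy
  rw [hrep x y hy, smul_smul, inv_mul_cancel₀ Real.pi_ne_zero, one_smul]

/-- conjugate Poisson kernel -/
noncomputable def qk (y s : ℝ) : ℝ := s / (y ^ 2 + s ^ 2)

lemma qk_meas (y : ℝ) : Measurable (qk y) := by unfold qk; fun_prop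

lemma qk_bdd {y : ℝ} (hy : 0 < y) (s : ℝ) : |qk y s| ≤ y⁻¹ := by
  unfold qk
  rw [abs_div, abs_of_pos (show 0 < y ^ 2 + s ^ 2 by positivity), div_le_iff₀ (by positivity), inv_mul_eq_div,
    le_div_iff₀ hy]
  nlinarith [sq_nonneg (y - |s|), sq_abs s, sq_nonneg y, sq_nonneg s]

/-- Cauchy type transform -/
noncomputable def cau (f : ℝ → ℂ) (z : ℂ) : ℂ := ∫ t : ℝ, f t * (I / (z - t))

lemma ker_eq (x : ℝ) {y : ℝ} (hy : 0 < y) (t : ℝ) :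
    I / ((x + y * I : ℂ) - t) = (pk y (x - t) : ℂ) + I * (qk y (x - t) : ℂ) := by
  have h1 : (x + y * I : ℂ) - t ≠ 0 := by
    intro h; have := congrArg Complex.im h; simp at this; linarith
  have h2 : ((y : ℂ) ^ 2 + (x - t) ^ 2) ≠ 0 := by
    have : y ^ 2 + (x - t) ^ 2 ≠ 0 := by positivity
    exact_mod_cast this
  unfold pk qk
  push_cast
  rw [div_eq_iff h1]
  field_simp
  linear_combination (-(y:ℂ) * (x - t) ) * I_sq

lemma sub_ne {z : ℂ} (hz : 0 < z.im) (t : ℝ) : z - t ≠ 0 := by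
  intro h; have := congrArg Complex.im h; simp at this; linarith

lemma norm_sub_ge {z : ℂ} (t : ℝ) : z.im ≤ ‖z - t‖ := by
  have := abs_im_le_norm (z - t); simp at this; exact (le_abs_self _).trans this

lemma ker_cont {z : ℂ} (hz : 0 < z.im) : Continuous (fun t : ℝ => I / (z - t)) :=
  continuous_const.div (by fun_prop) (sub_ne hz)

lemma ker_bdd {z : ℂ} (hz : 0 < z.im) (t : ℝ) : ‖I / (z - t)‖ ≤ z.im⁻¹ := by
  rw [norm_div, norm_I, one_div]
  exact inv_anti₀ hz (norm_sub_ge t)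

lemma cau_integrable {f : ℝ → ℂ} (hf : Integrable f) {z : ℂ} (hz : 0 < z.im) :
    Integrable (fun t : ℝ => f t * (I / (z - t))) :=
  hf.mul_bdd (c := z.im⁻¹) (ker_cont hz).aestronglyMeasurable (ae_of_all _ (ker_bdd hz))

lemma qk_smul_integrable {f : ℝ → ℂ} (hf : Integrable f) (x : ℝ) {y : ℝ} (hy : 0 < y) :
    Integrable (fun t : ℝ => qk y (x - t) • f t) :=
  hf.bdd_smul (φ := fun t : ℝ => qk y (x - t)) (y⁻¹) 
    (((qk_meas y).comp (measurable_const.sub measurable_id)).aestronglyMeasurable) (ae_of_all _ fun _ => qk_bdd hy _)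

lemma cau_eq {f : ℝ → ℂ} (hf : Integrable f) (x : ℝ) {y : ℝ} (hy : 0 < y) :
    cau f (x + y * I) = (∫ t : ℝ, pk y (x - t) • f t) + I * ∫ t : ℝ, qk y (x - t) • f t := by
  unfold cau
  rw [← integral_const_mul, ← integral_add (pk_smul_integrable (weight_of_integrable hf) hy x)
    ((qk_smul_integrable hf x hy).const_mul I)]
  congr 1; ext t
  rw [ker_eq x hy, real_smul, real_smul]; ring

lemma cau_diff {f : ℝ → ℂ} (hf : Integrable f) : DifferentiableOn ℂ (cau f) {w | 0 < w.im} := by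
  intro z hz
  have hz : 0 < z.im := hz
  apply DifferentiableAt.differentiableWithinAt
  set r := z.im / 2 with hr
  have hr0 : 0 < r := by positivity
  have him : ∀ w ∈ Metric.ball z r, r ≤ w.im := by
    intro w hw
    have h1 : ‖w - z‖ < r := by simpa [dist_eq_norm] using hw
    have := (abs_im_le_norm (w - z)).trans h1.le
    rw [abs_le] at this; simp at this; linarith [this.1]
  have := hasDerivAt_integral_of_dominated_loc_of_deriv_le (μ := volume)
    (F := fun (w : ℂ) (t : ℝ) => f t * (I / (w - t))) (F' := fun (w : ℂ) (t : ℝ) => f t * (-I / (w - t) ^ 2))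
    (x₀ := z) (s := Metric.ball z r) (bound := fun t => ‖f t‖ * (r ^ 2)⁻¹) (Metric.ball_mem_nhds z hr0)
    ?_ (cau_integrable hf hz) ?_ ?_ (hf.norm.mul_const _) ?_
  · exact this.2.differentiableAt
  · filter_upwards [Metric.ball_mem_nhds z hr0] with w hw
    exact (cau_integrable hf (hr0.trans_le (him w hw))).1
  · refine hf.1.mul ?_
    apply Continuous.aestronglyMeasurable
    exact continuous_const.div (by fun_prop) (fun t => pow_ne_zero 2 (sub_ne hz t))
  · refine ae_of_all _ fun t w hw => ?_
    rw [norm_mul, norm_div, norm_neg, norm_I, one_div, norm_pow]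
    gcongr
    exact (him w hw).trans (norm_sub_ge t)
  · refine ae_of_all _ fun t w hw => ?_
    have hw0 := sub_ne (hr0.trans_le (him w hw)) t
    have h1 : HasDerivAt (fun w : ℂ => w - t) 1 w := (hasDerivAt_id w).sub_const _
    have h2 := ((hasDerivAt_const w I).div h1 hw0).const_mul (f t)
    convert! h2 using 1
    ring

lemma cau_re_nonneg {g : ℝ → ℝ} (hg : Integrable g) (h0 : ∀ t, 0 ≤ g t) {z : ℂ} (hz : 0 < z.im) :
    0 ≤ (cau (fun t => (g t : ℂ)) z).re := by
  have hz' : z = (z.re : ℂ) + z.im * I := (re_add_im z).symm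
  unfold cau
  have : Integrable (fun t : ℝ => (g t : ℂ) * (I / (z - t))) := cau_integrable (f := fun t => (g t : ℂ)) hg.ofReal hz
  beta_reduce
  rw [← RCLike.re_eq_complex_re, ← integral_re this]
  apply integral_nonneg
  intro t
  simp only [Pi.zero_apply]
  rw [hz']
  have := ker_eq z.re hz t
  simp only [RCLike.re_eq_complex_re]
  rw [show ((z.re : ℂ) + z.im * I - (t:ℂ)) = (z.re : ℂ) + z.im * I - t from rfl, this]
  simp
  exact mul_nonneg (h0 t) (pk_nonneg hz _)

/-- regularising multiplier -/
noncomputable def rg (n : ℝ) (w : ℂ) : ℂ := n / (n + w)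

lemma rg_den {n : ℝ} (hn : 0 < n) {w : ℂ} (hw : 0 ≤ w.re) : n ≤ ‖(n + w : ℂ)‖ := by
  have := abs_re_le_norm (n + w : ℂ)
  simp at this
  exact (le_abs_self _).trans' (by linarith) |>.trans this

lemma rg_ne {n : ℝ} (hn : 0 < n) {w : ℂ} (hw : 0 ≤ w.re) : (n + w : ℂ) ≠ 0 := by
  have := rg_den hn hw
  exact norm_pos_iff.1 (hn.trans_le this)

lemma rg_le {n : ℝ} (hn : 0 < n) {w : ℂ} (hw : 0 ≤ w.re) : ‖rg n w‖ ≤ 1 := by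
  unfold rg
  have := rg_den hn hw
  rw [norm_div, div_le_one (hn.trans_le this)]
  simpa [abs_of_pos hn] using this

lemma mul_rg_le {n : ℝ} (hn : 0 < n) {w : ℂ} (hw : 0 ≤ w.re) : ‖w * rg n w‖ ≤ n := by
  unfold rg
  have h := rg_den hn hw
  rw [norm_mul, norm_div, ← mul_div_assoc, div_le_iff₀ (hn.trans_le h), mul_comm]
  simp only [norm_real, Real.norm_eq_abs, abs_of_pos hn]
  gcongr
  refine (pow_le_pow_iff_left₀ (norm_nonneg _) (norm_nonneg _) two_ne_zero).1 ?_
  rw [Complex.sq_norm, Complex.sq_norm, Complex.normSq_apply, Complex.normSq_apply]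
  simp
  nlinarith [mul_nonneg hn.le hw]

lemma rg_tendsto (w : ℂ) : Tendsto (fun k : ℕ => rg ((k : ℝ) + 1) w) atTop (𝓝 1) := by
  have h1 : Tendsto (fun k : ℕ => ((1 : ℂ) / ((k : ℂ) + 1))) atTop (𝓝 0) := tendsto_one_div_add_atTop_nhds_zero_nat
  have h2 : Tendsto (fun k : ℕ => (1 + w * (1 / ((k : ℂ) + 1)))⁻¹) atTop (𝓝 1) := by
    have := ((h1.const_mul w).const_add 1).inv₀ (by simp)
    simpa using this
  refine h2.congr fun k => ?_
  unfold rg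
  have : (k : ℂ) + 1 ≠ 0 := by exact_mod_cast Nat.succ_ne_zero k
  push_cast
  rw [← inv_div]
  field_simp

lemma rg_diff {n : ℝ} (hn : 0 < n) {F : ℂ → ℂ} (hF : DifferentiableOn ℂ F {w | 0 < w.im})
    (h0 : ∀ z : ℂ, 0 < z.im → 0 ≤ (F z).re) : DifferentiableOn ℂ (fun z => rg n (F z)) {w | 0 < w.im} := by
  unfold rg
  exact DifferentiableOn.div (by fun_prop) (hF.const_add _) (fun z hz => rg_ne hn (h0 z hz))

lemma line_im (x : ℝ) {y : ℝ} (hy : 0 < y) : 0 < ((x : ℂ) + y * I).im := by simpa using hy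

theorem pos_boundary {F : ℂ → ℂ} (hF : DifferentiableOn ℂ F {w | 0 < w.im})
    (h0 : ∀ z : ℂ, 0 < z.im → 0 ≤ (F z).re) :
    ∀ᵐ x : ℝ, ∃ l : ℂ, 0 ≤ l.re ∧ Tendsto (fun y : ℝ => F (x + y * I)) (𝓝[>] 0) (𝓝 l) := by
  have hn : ∀ k : ℕ, (0 : ℝ) < (k : ℝ) + 1 := fun k => by positivity
  choose b hbw hrep hlim using fun k : ℕ => fatou (rg_diff (hn k) hF h0) (M := 1) (fun w hw => rg_le (hn k) (h0 w hw))
  have hlim' := ae_all_iff.2 hlim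
  have hzero : ∀ᵐ x : ℝ, b 0 x = 0 → ∀ k, b k x = 0 := by
    filter_upwards [hlim'] with x hx hx0 k
    refine tendsto_nhds_unique (hx k) ?_
    have h1 := hx 0
    rw [hx0] at h1
    have h2 : Tendsto (fun y : ℝ => ((k : ℂ) + 1) * rg (((0 : ℕ) : ℝ) + 1) (F (x + y * I)) /
        (k * rg (((0 : ℕ) : ℝ) + 1) (F (x + y * I)) + 1)) (𝓝[>] 0) (𝓝 0) := by
      have := (h1.const_mul ((k : ℂ) + 1)).div ((h1.const_mul (k : ℂ)).add_const 1) (by simp)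
      rw [mul_zero, mul_zero, zero_add, zero_div] at this
      exact this
    refine h2.congr' ?_
    filter_upwards [self_mem_nhdsWithin] with y hy
    have hre := h0 _ (line_im x hy)
    have e1 := rg_ne (hn 0) hre
    have e2 := rg_ne (hn k) hre
    unfold rg
    simp at e1 e2 ⊢
    have e3 : (k : ℂ) * (1 + F (x + y * I))⁻¹ + 1 = (k + 1 + F (x + y * I)) * (1 + F (x + y * I))⁻¹ := by
      field_simp; ring
    rw [e3]
    field_simp
  have hb1 : ∀ k, ∀ᵐ x : ℝ, ‖b k x‖ ≤ 1 := by
    intro k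
    filter_upwards [hlim k] with x hx
    refine le_of_tendsto hx.norm ?_
    filter_upwards [self_mem_nhdsWithin] with y hy
    exact rg_le (hn k) (h0 _ (line_im x hy))
  have hbm : AEStronglyMeasurable (b 0) := (locInt_of_weight (hbw 0)).aestronglyMeasurable
  have hE : NullMeasurableSet {t | b 0 t = 0} := nullMeasurableSet_eq_fun hbm.aemeasurable aemeasurable_const
  set h : ℝ → ℝ := {t | b 0 t = 0}.indicator (fun t => pk 1 (0 - t)) with hh
  have hp := pk_sub_integrable one_pos 0
  have hhi : Integrable h := hp.indicator₀ hE
  have hhnn : 0 ≤ h := fun t => indicator_nonneg (fun t _ => pk_nonneg one_pos _) t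
  have hle : ∀ k : ℕ, Real.pi * ‖rg ((k : ℝ) + 1) (F ((0:ℝ) + (1:ℝ) * I))‖ ≤ Real.pi - ∫ t, h t := by
    intro k
    have e := hrep k 0 1 one_pos
    have e2 := congrArg norm e
    rw [norm_smul, Real.norm_eq_abs, abs_of_pos Real.pi_pos] at e2
    rw [← e2, ← pk_sub_integral one_pos 0, ← integral_sub hp hhi]
    refine norm_integral_le_of_norm_le (hp.sub hhi) ?_
    filter_upwards [hb1 k, hzero] with t ht ht0
    rw [norm_smul, Real.norm_eq_abs, abs_of_nonneg (pk_nonneg one_pos _)]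
    by_cases hb : b 0 t = 0
    · rw [ht0 hb k, hh, indicator_of_mem (show t ∈ {t | b 0 t = 0} from hb)]; simp
    · rw [hh, indicator_of_notMem (show t ∉ {t | b 0 t = 0} from hb), sub_zero]
      exact mul_le_of_le_one_right (pk_nonneg one_pos _) ht
  have hint : ∫ t, h t = 0 := by
    have h1 := ((rg_tendsto (F ((0:ℝ) + (1:ℝ) * I))).norm.const_mul Real.pi)
    have := le_of_tendsto' h1 hle
    have h2 := integral_nonneg hhnn (μ := volume)
    simp at this
    linarith
  rw [integral_eq_zero_iff_of_nonneg hhnn hhi] at hint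
  filter_upwards [hint, hlim 0] with x hx hxl
  have hb0 : b 0 x ≠ 0 := by
    intro hb
    rw [hh, indicator_of_mem (show x ∈ {t | b 0 t = 0} from hb)] at hx
    have : 0 < pk 1 (0 - x) := by unfold pk; positivity
    simp at hx this; linarith
  have hT : Tendsto (fun y : ℝ => F (x + y * I)) (𝓝[>] 0) (𝓝 ((b 0 x)⁻¹ - 1)) := by
    refine ((hxl.inv₀ hb0).sub_const 1).congr' ?_
    filter_upwards [self_mem_nhdsWithin] with y hy
    unfold rg; simp
  refine ⟨_, ?_, hT⟩
  refine ge_of_tendsto ((continuous_re.tendsto _).comp hT) ?_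
  filter_upwards [self_mem_nhdsWithin] with y hy
  exact h0 _ (line_im x hy)

/-- Smirnov-type theorem for finite combinations of functions with positive real part. -/
theorem smirnov {Fj : Fin 4 → ℂ → ℂ} (hF : ∀ j, DifferentiableOn ℂ (Fj j) {w | 0 < w.im})
    (h0 : ∀ j, ∀ z : ℂ, 0 < z.im → 0 ≤ (Fj j z).re) (c : Fin 4 → ℂ) (hc : ∀ j, ‖c j‖ ≤ 1)
    {G : ℝ → ℂ} (hG : Integrable G)
    (hlim : ∀ᵐ x : ℝ, Tendsto (fun y : ℝ => ∑ j, c j * Fj j (x + y * I)) (𝓝[>] 0) (𝓝 (G x)))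
    (x y : ℝ) (hy : 0 < y) :
    ∫ t : ℝ, pk y (x - t) • G t = Real.pi • ∑ j, c j * Fj j (x + y * I) := by
  have hn : ∀ k : ℕ, (0 : ℝ) < (k : ℝ) + 1 := fun k => by positivity
  set S : ℂ → ℂ := fun z => ∑ j, c j * Fj j z with hS
  set Mk : ℕ → ℂ → ℂ := fun k z => ∏ j, rg ((k : ℝ) + 1) (Fj j z) with hMk
  have hMle : ∀ k z, 0 < z.im → ‖Mk k z‖ ≤ 1 := by
    intro k z hz
    rw [hMk]; simp only [norm_prod]
    exact Finset.prod_le_one (fun _ _ => norm_nonneg _) (fun j _ => rg_le (hn k) (h0 j z hz))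
  have hdiff : ∀ k, DifferentiableOn ℂ (fun z => S z * Mk k z) {w | 0 < w.im} := by
    intro k
    refine DifferentiableOn.mul ?_ ?_
    · exact DifferentiableOn.fun_sum fun j _ => (hF j).const_mul _
    · exact DifferentiableOn.fun_finsetProd fun j _ => rg_diff (hn k) (hF j) (h0 j)
  have hbd : ∀ k, ∀ z : ℂ, 0 < z.im → ‖S z * Mk k z‖ ≤ 4 * ((k : ℝ) + 1) := by
    intro k z hz
    rw [hS, Finset.sum_mul]
    refine (norm_sum_le _ _).trans ?_
    calc _ ≤ ∑ j : Fin 4, ((k : ℝ) + 1) := by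
          apply Finset.sum_le_sum
          intro j _
          have e : c j * Fj j z * Mk k z = c j * (Fj j z * rg ((k : ℝ) + 1) (Fj j z)) *
              ∏ i ∈ Finset.univ.erase j, rg ((k : ℝ) + 1) (Fj i z) := by
            rw [hMk]; simp only
            rw [← Finset.mul_prod_erase Finset.univ _ (Finset.mem_univ j)]; ring
          rw [e, norm_mul, norm_mul, norm_prod]
          have h1 : ∏ i ∈ Finset.univ.erase j, ‖rg ((k : ℝ) + 1) (Fj i z)‖ ≤ 1 :=
            Finset.prod_le_one (fun _ _ => norm_nonneg _) (fun j _ => rg_le (hn k) (h0 j z hz))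
          have h2 := mul_rg_le (hn k) (h0 j z hz)
          calc _ ≤ 1 * ((k : ℝ) + 1) * 1 := by gcongr; exact hc j
            _ = _ := by ring
      _ = _ := by simp; ring
  choose b hbw hrep hblim using fun k : ℕ => fatou (hdiff k) (hbd k)
  have hpos := ae_all_iff.2 fun j => pos_boundary (hF j) (h0 j)
  have hkey : ∀ᵐ t : ℝ, (∀ k, ‖b k t‖ ≤ ‖G t‖) ∧ Tendsto (fun k => b k t) atTop (𝓝 (G t)) := by
    filter_upwards [hpos, hlim, ae_all_iff.2 hblim] with t ht htG htb
    choose l hl0 hl using ht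
    have hb : ∀ k, b k t = G t * ∏ j, rg ((k : ℝ) + 1) (l j) := by
      intro k
      refine tendsto_nhds_unique (htb k) (htG.mul (tendsto_finsetProd _ fun j _ => ?_))
      unfold rg
      exact tendsto_const_nhds.div ((hl j).const_add _) (rg_ne (hn k) (hl0 j))
    constructor
    · intro k
      rw [hb, norm_mul, norm_prod]
      exact mul_le_of_le_one_right (norm_nonneg _)
        (Finset.prod_le_one (fun _ _ => norm_nonneg _) (fun j _ => rg_le (hn k) (hl0 j)))
    · simp_rw [hb]
      have := (tendsto_finsetProd Finset.univ fun j (_ : j ∈ Finset.univ) => rg_tendsto (l j)).const_mul (G t)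
      simpa using this
  have hz := line_im x hy
  have hL : Tendsto (fun k => ∫ t : ℝ, pk y (x - t) • b k t) atTop (𝓝 (∫ t : ℝ, pk y (x - t) • G t)) := by
    refine tendsto_integral_of_dominated_convergence (fun t => ‖pk y (x - t) • G t‖) ?_ ?_ ?_ ?_
    · exact fun k => (pk_smul_integrable (hbw k) hy x).1
    · exact (pk_smul_integrable (weight_of_integrable hG) hy x).norm
    · intro k
      filter_upwards [hkey] with t ht
      rw [norm_smul, norm_smul]; gcongr; exact ht.1 k
    · filter_upwards [hkey] with t ht
      exact ht.2.const_smul _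
  refine tendsto_nhds_unique hL ?_
  simp_rw [hrep _ x y hy]
  refine Tendsto.const_smul ?_ _
  have := (tendsto_finsetProd Finset.univ fun j (_ : j ∈ Finset.univ) => rg_tendsto (Fj j (x + y * I))).const_mul (S (x + y * I))
  simpa using this

noncomputable def prt (f : ℝ → ℂ) : Fin 4 → ℝ → ℝ :=
  ![fun t => max (f t).re 0, fun t => max (-(f t).re) 0, fun t => max (f t).im 0, fun t => max (-(f t).im) 0]

noncomputable def prc : Fin 4 → ℂ := ![1, -1, I, -I]

lemma prc_le (j : Fin 4) : ‖prc j‖ ≤ 1 := by fin_cases j <;> simp [prc]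

lemma prt_nonneg (f : ℝ → ℂ) (j : Fin 4) (t : ℝ) : 0 ≤ prt f j t := by fin_cases j <;> simp [prt]

lemma prt_integrable {f : ℝ → ℂ} (hf : Integrable f) (j : Fin 4) : Integrable (prt f j) := by
  have h1 : Integrable (fun t => (f t).re) := hf.re
  have h2 : Integrable (fun t => (f t).im) := hf.im
  fin_cases j
  · exact h1.pos_part
  · exact h1.neg.pos_part
  · exact h2.pos_part
  · exact h2.neg.pos_part

lemma prt_sum (f : ℝ → ℂ) (t : ℝ) : f t = ∑ j, prc j * (prt f j t : ℂ) := by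
  have e : ∀ a : ℝ, max a 0 - max (-a) 0 = a := fun a => max_zero_sub_eq_self a
  have h1 := e (f t).re
  have h2 := e (f t).im
  rw [Fin.sum_univ_four]
  simp only [prc, prt]
  simp only [Matrix.cons_val]
  conv_lhs => rw [← re_add_im (f t), ← h1, ← h2]
  push_cast; ring

lemma cau_sum {f : ℝ → ℂ} (hf : Integrable f) {z : ℂ} (hz : 0 < z.im) :
    cau f z = ∑ j, prc j * cau (fun t => (prt f j t : ℂ)) z := by
  unfold cau
  simp_rw [← integral_const_mul]
  rw [← integral_finsetSum _ fun j _ => ((cau_integrable (f := fun t => (prt f j t : ℂ)) (prt_integrable hf j).ofReal hz).const_mul (prc j))]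
  congr 1; ext t
  conv_lhs => rw [prt_sum f t, Finset.sum_mul]
  simp_rw [mul_assoc]

lemma prt_diff {f : ℝ → ℂ} (hf : Integrable f) (j : Fin 4) :
    DifferentiableOn ℂ (cau (fun t => (prt f j t : ℂ))) {w | 0 < w.im} :=
  cau_diff (f := fun t => (prt f j t : ℂ)) (prt_integrable hf j).ofReal

lemma prt_re {f : ℝ → ℂ} (hf : Integrable f) (j : Fin 4) (z : ℂ) (hz : 0 < z.im) :
    0 ≤ (cau (fun t => (prt f j t : ℂ)) z).re :=
  cau_re_nonneg (prt_integrable hf j) (prt_nonneg f j) hz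

theorem cau_boundary {f : ℝ → ℂ} (hf : Integrable f) :
    ∀ᵐ x : ℝ, ∃ l : ℂ, Tendsto (fun y : ℝ => cau f (x + y * I)) (𝓝[>] 0) (𝓝 l) := by
  filter_upwards [ae_all_iff.2 fun j => pos_boundary (prt_diff hf j) (prt_re hf j)] with x hx
  choose l _ hl using hx
  refine ⟨∑ j, prc j * l j, (tendsto_finsetSum _ fun j _ => (hl j).const_mul (prc j)).congr' ?_⟩
  filter_upwards [self_mem_nhdsWithin] with y hy
  exact (cau_sum hf (line_im x hy)).symm

theorem cau_rep {f : ℝ → ℂ} (hf : Integrable f) {G : ℝ → ℂ} (hG : Integrable G)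
    (hlim : ∀ᵐ x : ℝ, Tendsto (fun y : ℝ => cau f (x + y * I)) (𝓝[>] 0) (𝓝 (G x)))
    (x y : ℝ) (hy : 0 < y) :
    ∫ t : ℝ, pk y (x - t) • G t = Real.pi • cau f (x + y * I) := by
  rw [cau_sum hf (line_im x hy)]
  refine smirnov (prt_diff hf) (prt_re hf) prc prc_le hG ?_ x y hy
  filter_upwards [hlim] with t ht
  refine ht.congr' ?_
  filter_upwards [self_mem_nhdsWithin] with y hy
  exact cau_sum hf (line_im t hy)

/-- truncated Hilbert kernel -/
noncomputable def hk (y s : ℝ) : ℝ := {s : ℝ | y ≤ |s|}.indicator (fun s => s⁻¹) s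

lemma hk_set (y : ℝ) : MeasurableSet {s : ℝ | y ≤ |s|} :=
  measurableSet_le measurable_const (by fun_prop)

lemma hk_meas (y : ℝ) : Measurable (hk y) := by
  unfold hk
  exact Measurable.indicator (by fun_prop) (hk_set y)

lemma hk_bdd {y : ℝ} (hy : 0 < y) (s : ℝ) : |hk y s| ≤ y⁻¹ := by
  unfold hk
  by_cases h : y ≤ |s|
  · rw [indicator_of_mem (show s ∈ {s : ℝ | y ≤ |s|} from h), abs_inv]
    exact inv_anti₀ hy h
  · rw [indicator_of_notMem (show s ∉ {s : ℝ | y ≤ |s|} from h)]; simp [hy.le]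

lemma hk_smul_integrable {f : ℝ → ℂ} (hf : Integrable f) (x : ℝ) {y : ℝ} (hy : 0 < y) :
    Integrable (fun t : ℝ => hk y (x - t) • f t) :=
  hf.bdd_smul (φ := fun t : ℝ => hk y (x - t)) (y⁻¹) 
    (((hk_meas y).comp (measurable_const.sub measurable_id)).aestronglyMeasurable) (ae_of_all _ fun _ => hk_bdd hy _)

lemma trunc_eq (f : ℝ → ℂ) (x y : ℝ) :
    ∫ t in {t : ℝ | y ≤ |x - t|}, f t / ((x : ℂ) - (t : ℂ)) = ∫ t, hk y (x - t) • f t := by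
  have hS : MeasurableSet {t : ℝ | y ≤ |x - t|} := measurableSet_le measurable_const (by fun_prop)
  rw [← integral_indicator hS]
  congr 1; ext t
  unfold hk
  by_cases h : y ≤ |x - t|
  · rw [indicator_of_mem (show t ∈ {t : ℝ | y ≤ |x - t|} from h), indicator_of_mem (show x - t ∈ {s : ℝ | y ≤ |s|} from h),
      real_smul]
    push_cast; rw [div_eq_inv_mul]
  · rw [indicator_of_notMem (show t ∉ {t : ℝ | y ≤ |x - t|} from h), indicator_of_notMem (show x - t ∉ {s : ℝ | y ≤ |s|} from h)]
    simp

lemma diff_bdd {y : ℝ} (hy : 0 < y) (s : ℝ) : |qk y s - hk y s| ≤ 1 * pk y s := by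
  unfold hk qk pk
  have hp : 0 < y ^ 2 + s ^ 2 := by positivity
  by_cases h : y ≤ |s|
  · rw [indicator_of_mem (show s ∈ {s : ℝ | y ≤ |s|} from h)]
    have hs : 0 < |s| := hy.trans_le h
    have hs0 : s ≠ 0 := abs_pos.1 hs
    have e : s / (y ^ 2 + s ^ 2) - s⁻¹ = - (y ^ 2 / (s * (y ^ 2 + s ^ 2))) := by field_simp; ring
    rw [e, abs_neg, abs_div, abs_mul, abs_of_pos hp, abs_of_pos (pow_pos hy 2), one_mul, div_le_div_iff₀ (by positivity) hp]
    nlinarith [mul_le_mul_of_nonneg_left h (mul_pos hy hp).le]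
  · rw [indicator_of_notMem (show s ∉ {s : ℝ | y ≤ |s|} from h), sub_zero, abs_div, abs_of_pos hp, one_mul]
    gcongr
    exact (not_le.1 h).le

lemma diff_integral (y : ℝ) : ∫ s, (qk y s - hk y s) = 0 := by
  have h : ∫ s, (qk y s - hk y s) = - ∫ s, (qk y s - hk y s) := by
    conv_lhs => rw [← integral_neg_eq_self]
    rw [← integral_neg]
    congr 1; ext s
    unfold qk hk indicator
    by_cases hs : y ≤ |s|
    · simp [hs, inv_neg]; ring
    · simp [hs]; ring
  linarith

theorem hilbert_ae {f : ℝ → ℂ} (hf : Integrable f) :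
    ∀ᵐ x : ℝ, ∀ l : ℂ, Tendsto (fun y : ℝ => cau f (x + y * I)) (𝓝[>] 0) (𝓝 l) →
      l = Real.pi • (f x + I * hilbertT f x) := by
  filter_upwards [kernel_ae (weight_of_integrable hf), poisson_ae (weight_of_integrable hf)] with x hx hP l hl
  have h1 := hx (fun y s => qk y s - hk y s) 1 0 (fun y => (qk_meas y).sub (hk_meas y)) zero_le_one
    (fun y hy s => diff_bdd hy s) (fun y _ => diff_integral y)
  rw [zero_smul] at h1
  have h2 : Tendsto (fun ε : ℝ => ∫ y in {y : ℝ | ε ≤ |x - y|}, f y / ((x : ℂ) - (y : ℂ))) (𝓝[>] 0)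
      (𝓝 (-I * (l - Real.pi • f x) - 0)) := by
    refine (((hl.sub hP).const_mul (-I)).sub h1).congr' ?_
    filter_upwards [self_mem_nhdsWithin] with y hy
    have hy : 0 < y := hy
    rw [trunc_eq, cau_eq hf x hy]
    simp_rw [sub_smul]
    rw [integral_sub (qk_smul_integrable hf x hy) (hk_smul_integrable hf x hy)]
    linear_combination (-(∫ t : ℝ, qk y (x - t) • f t)) * I_sq
  unfold hilbertT
  rw [h2.limUnder_eq, sub_zero]
  have : (Real.pi : ℂ) ≠ 0 := by exact_mod_cast Real.pi_ne_zero
  simp only [real_smul]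
  push_cast
  field_simp
  linear_combination (l - Real.pi * f x) * I_sq

theorem qk_eq_pk {f : ℝ → ℂ} (hf : MemH1 f) (x y : ℝ) (hy : 0 < y) :
    ∫ t : ℝ, qk y (x - t) • f t = ∫ t : ℝ, pk y (x - t) • hilbertT f t := by
  obtain ⟨h1, h2⟩ := hf
  have hG : Integrable (fun x => Real.pi • (f x + I * hilbertT f x)) := (h1.add (h2.const_mul I)).smul Real.pi
  have h := cau_rep h1 hG (by
    filter_upwards [cau_boundary h1, hilbert_ae h1] with x hx hh
    obtain ⟨l, hl⟩ := hx
    rw [← hh l hl]; exact hl) x y hy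
  rw [cau_eq h1 x hy] at h
  have e : (fun t : ℝ => pk y (x - t) • (Real.pi • (f t + I * hilbertT f t))) =
      fun t : ℝ => Real.pi • (pk y (x - t) • f t + I * (pk y (x - t) • hilbertT f t)) := by
    ext t; simp only [real_smul]; ring
  rw [e, integral_smul, integral_add (pk_smul_integrable (weight_of_integrable h1) hy x)
    ((pk_smul_integrable (weight_of_integrable h2) hy x).const_mul I), integral_const_mul] at h
  have h3 := smul_right_injective ℂ Real.pi_ne_zero h
  exact (mul_left_cancel₀ I_ne_zero (add_left_cancel h3)).symm

theorem hilbert_of_qk_eq_pk {g h : ℝ → ℂ} (hg : Integrable g) (hh : Integrable h)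
    (H : ∀ x y : ℝ, 0 < y → ∫ t : ℝ, qk y (x - t) • g t = ∫ t : ℝ, pk y (x - t) • h t) :
    hilbertT g =ᵐ[volume] h := by
  filter_upwards [hilbert_ae hg, poisson_ae (weight_of_integrable hg), poisson_ae (weight_of_integrable hh)] with x hx h1 h2
  have h3 := hx (Real.pi • g x + I * (Real.pi • h x)) (by
    refine (h1.add (h2.const_mul I)).congr' ?_
    filter_upwards [self_mem_nhdsWithin] with y hy
    rw [cau_eq hg x hy, H x y hy])
  have h4 : Real.pi • (g x + I * h x) = Real.pi • (g x + I * hilbertT g x) := by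
    rw [← h3]; simp only [real_smul]; ring
  exact (mul_left_cancel₀ I_ne_zero (add_left_cancel (smul_right_injective ℂ Real.pi_ne_zero h4))).symm

lemma div_qmp : Measure.QuasiMeasurePreserving (fun p : ℝ × ℝ => p.1 / p.2)
    (volume.prod (volume.restrict (Ioi (0:ℝ)))) volume := by
  have hm : Measurable (fun p : ℝ × ℝ => p.1 / p.2) := measurable_fst.div measurable_snd
  refine ⟨hm, Measure.AbsolutelyContinuous.mk fun s hs h0 => ?_⟩
  rw [Measure.map_apply hm hs, Measure.prod_apply_symm (hm hs)]
  rw [lintegral_eq_zero_iff' ((measurable_measure_prodMk_right (hm hs)).aemeasurable)]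
  filter_upwards [ae_restrict_mem measurableSet_Ioi] with t ht
  have ht : (0:ℝ) < t := ht
  have := Real.volume_preimage_mul_right (inv_ne_zero ht.ne') s
  rw [h0, mul_zero] at this
  exact this

lemma haus_integrable {φ : ℝ → ℝ} (hint : IntegrableOn φ (Ioi 0))
    {f : ℝ → ℂ} (hf : Integrable f) :
    Integrable (fun p : ℝ × ℝ => (φ p.2 / p.2) • f (p.1 / p.2))
      (volume.prod (volume.restrict (Ioi (0:ℝ)))) := by
  have hm : AEStronglyMeasurable (fun p : ℝ × ℝ => (φ p.2 / p.2) • f (p.1 / p.2))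
      (volume.prod (volume.restrict (Ioi (0:ℝ)))) := by
    refine AEStronglyMeasurable.smul (𝕜 := ℝ) ?_ (hf.1.comp_quasiMeasurePreserving div_qmp)
    have : AEStronglyMeasurable (fun t => φ t / t) (volume.restrict (Ioi (0:ℝ))) :=
      (hint.1.aemeasurable.div measurable_id.aemeasurable).aestronglyMeasurable
    exact this.comp_snd
  rw [integrable_prod_iff' hm]
  constructor
  · filter_upwards [ae_restrict_mem measurableSet_Ioi] with t ht
    have ht : (0:ℝ) < t := ht
    exact (hf.comp_div ht.ne').smul (φ t / t)
  · have : Integrable (fun t => ‖φ t‖ * ∫ x, ‖f x‖) (volume.restrict (Ioi (0:ℝ))) := hint.norm.mul_const _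
    refine this.congr ?_
    filter_upwards [ae_restrict_mem measurableSet_Ioi] with t ht
    have ht : (0:ℝ) < t := ht
    simp_rw [norm_smul]
    rw [integral_const_mul, Measure.integral_comp_div (fun x => ‖f x‖) t, norm_div, Real.norm_eq_abs t, smul_eq_mul]
    have : |t| ≠ 0 := by positivity
    field_simp

lemma haus_L1 {φ : ℝ → ℝ} (hint : IntegrableOn φ (Ioi 0))
    {f : ℝ → ℂ} (hf : Integrable f) : Integrable (hausdorffR φ f) :=
  (haus_integrable hint hf).integral_prod_left

lemma haus_norm {φ : ℝ → ℝ} (hφ : ∀ t, 0 ≤ φ t) (hint : IntegrableOn φ (Ioi 0))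
    {f : ℝ → ℂ} (hf : Integrable f) :
    ∫ x, ‖hausdorffR φ f x‖ ≤ (∫ t in Ioi 0, φ t) * ∫ x, ‖f x‖ := by
  have hi := haus_integrable hint hf
  calc ∫ x, ‖hausdorffR φ f x‖ ≤ ∫ x, ∫ t in Ioi 0, ‖(φ t / t) • f (x / t)‖ :=
        integral_mono (haus_L1 hint hf).norm hi.norm.integral_prod_left fun x => norm_integral_le_integral_norm _
    _ = ∫ t in Ioi 0, ∫ x, ‖(φ t / t) • f (x / t)‖ := integral_integral_swap hi.norm
    _ = ∫ t in Ioi 0, φ t * ∫ x, ‖f x‖ := by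
        refine setIntegral_congr_fun measurableSet_Ioi fun t ht => ?_
        have ht : (0:ℝ) < t := ht
        simp_rw [norm_smul]
        rw [integral_const_mul, Measure.integral_comp_div (fun x => ‖f x‖) t, norm_div, Real.norm_eq_abs t,
          smul_eq_mul, Real.norm_of_nonneg (hφ t)]
        have : |t| ≠ 0 := by positivity
        field_simp
    _ = _ := integral_mul_const _ _

lemma eLp_one {f : ℝ → ℂ} (hf : Integrable f) : eLpNorm f 1 volume = ENNReal.ofReal (∫ x, ‖f x‖) := by
  rw [eLpNorm_one_eq_lintegral_enorm, ofReal_integral_norm_eq_lintegral_enorm hf]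

lemma haus_eLp {φ : ℝ → ℝ} (hφ : ∀ t, 0 ≤ φ t) (hint : IntegrableOn φ (Ioi 0))
    {f : ℝ → ℂ} (hf : Integrable f) :
    eLpNorm (hausdorffR φ f) 1 volume ≤ ENNReal.ofReal (∫ t in Ioi 0, φ t) * eLpNorm f 1 volume := by
  rw [eLp_one hf, eLp_one (haus_L1 hint hf), ← ENNReal.ofReal_mul (integral_nonneg hφ)]
  exact ENNReal.ofReal_le_ofReal (haus_norm hφ hint hf)

theorem haus_dual {φ : ℝ → ℝ} (hint : IntegrableOn φ (Ioi 0))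
    {f : ℝ → ℂ} (hf : Integrable f) {K : ℝ → ℝ} (hK : Measurable K) (C : ℝ) (hC : ∀ x, |K x| ≤ C) :
    ∫ x, K x • hausdorffR φ f x = ∫ t in Ioi 0, φ t • ∫ s, K (t * s) • f s := by
  have hi := haus_integrable hint hf
  have hi2 : Integrable (fun p : ℝ × ℝ => K p.1 • ((φ p.2 / p.2) • f (p.1 / p.2)))
      (volume.prod (volume.restrict (Ioi (0:ℝ)))) :=
    hi.bdd_smul (φ := fun p : ℝ × ℝ => K p.1) C (hK.comp measurable_fst).aestronglyMeasurable
      (ae_of_all _ fun p => hC p.1)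
  calc ∫ x, K x • hausdorffR φ f x = ∫ x, ∫ t in Ioi 0, K x • ((φ t / t) • f (x / t)) := by
        congr 1; ext x; rw [integral_smul]; rfl
    _ = ∫ t in Ioi 0, ∫ x, K x • ((φ t / t) • f (x / t)) := integral_integral_swap hi2
    _ = _ := by
        refine setIntegral_congr_fun measurableSet_Ioi fun t ht => ?_
        have ht : (0:ℝ) < t := ht
        have e : (fun x => K x • ((φ t / t) • f (x / t))) =
            fun x => (φ t / t) • (fun s => K (t * s) • f s) (x / t) := by
          ext x
          simp only [mul_div_cancel₀ x ht.ne', smul_comm (K x)]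
        simp only [e]
        rw [integral_smul, Measure.integral_comp_div (fun s => K (t * s) • f s) t, smul_smul, abs_of_pos ht,
          div_mul_cancel₀ _ ht.ne']

lemma qk_scale {t : ℝ} (ht : 0 < t) (x y s : ℝ) : qk y (x - t * s) = t⁻¹ * qk (y / t) (x / t - s) := by
  unfold qk
  have e : (y / t) ^ 2 + (x / t - s) ^ 2 = (y ^ 2 + (x - t * s) ^ 2) / t ^ 2 := by field_simp
  have e2 : x / t - s = (x - t * s) / t := by field_simp
  rw [e, e2]
  by_cases h : y ^ 2 + (x - t * s) ^ 2 = 0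
  · simp [h]
  · field_simp

lemma pk_scale {t : ℝ} (ht : 0 < t) (x y s : ℝ) : pk y (x - t * s) = t⁻¹ * pk (y / t) (x / t - s) := by
  unfold pk
  have e : (y / t) ^ 2 + (x / t - s) ^ 2 = (y ^ 2 + (x - t * s) ^ 2) / t ^ 2 := by field_simp
  rw [e]
  by_cases h : y ^ 2 + (x - t * s) ^ 2 = 0
  · simp [h]
  · field_simp

theorem haus_hilbert {φ : ℝ → ℝ} (hint : IntegrableOn φ (Ioi 0)) {f : ℝ → ℂ} (hf : MemH1 f) :
    hilbertT (hausdorffR φ f) =ᵐ[volume] hausdorffR φ (hilbertT f) := by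
  refine hilbert_of_qk_eq_pk (haus_L1 hint hf.1) (haus_L1 hint hf.2) fun x y hy => ?_
  rw [haus_dual hint hf.1 (K := fun t => qk y (x - t)) ((qk_meas y).comp (measurable_const.sub measurable_id)) _ (fun t => qk_bdd hy (x - t)),
    haus_dual hint hf.2 (K := fun t => pk y (x - t)) ((pk_meas y).comp (measurable_const.sub measurable_id)) y⁻¹ 
      (fun t => by rw [abs_of_nonneg (pk_nonneg hy _)]; exact pk_le_inv hy _)]
  refine setIntegral_congr_fun measurableSet_Ioi fun t ht => ?_
  have ht : (0:ℝ) < t := ht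
  simp only [qk_scale ht, pk_scale ht, mul_smul]
  rw [integral_smul, integral_smul, qk_eq_pk hf _ _ (div_pos hy ht)]

theorem haus_bounded {φ : ℝ → ℝ} (hφ : ∀ t, 0 ≤ φ t) (hint : IntegrableOn φ (Ioi 0)) {f : ℝ → ℂ} (hf : MemH1 f) :
    MemH1 (hausdorffR φ f) ∧
      h1Norm (hausdorffR φ f) ≤ ENNReal.ofReal (∫ t in Ioi 0, φ t) * h1Norm f := by
  have h := haus_hilbert hint hf
  refine ⟨⟨haus_L1 hint hf.1, (haus_L1 hint hf.2).congr h.symm⟩, ?_⟩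
  unfold h1Norm
  rw [eLpNorm_congr_ae h, mul_add]
  exact add_le_add (haus_eLp hφ hint hf.1) (haus_eLp hφ hint hf.2)

lemma toC {g : ℝ → ℝ} (hg : Integrable g) : Integrable (fun t => (g t : ℂ)) := hg.ofReal

/-- test function -/
noncomputable def tF (b x : ℝ) : ℝ := qk 1 x - qk b x
/-- its Hilbert transform -/
noncomputable def tH (b x : ℝ) : ℝ := pk b x - pk 1 x
/-- the associated analytic function -/
noncomputable def tG (b : ℝ) (w : ℂ) : ℂ := 1 / (w + I) - 1 / (w + b * I)

lemma tF_eq {b : ℝ} (hb : 2 ≤ b) (x : ℝ) : tF b x = x * (b ^ 2 - 1) / ((1 + x ^ 2) * (b ^ 2 + x ^ 2)) := by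
  unfold tF qk
  have : 0 < b ^ 2 + x ^ 2 := by positivity
  field_simp
  ring

lemma tF_meas (b : ℝ) : Measurable (tF b) := (qk_meas 1).sub (qk_meas b)
lemma tH_meas (b : ℝ) : Measurable (tH b) := (pk_meas b).sub (pk_meas 1)

lemma tF_integrable {b : ℝ} (hb : 2 ≤ b) : Integrable (tF b) := by
  refine ((pk_integrable (y := 1) one_pos).const_mul (b ^ 2 - 1)).mono' (tF_meas b).aestronglyMeasurable
    (ae_of_all _ fun x => ?_)
  have h1 : 0 < b ^ 2 - 1 := by nlinarith
  have h2 : 0 < 1 + x ^ 2 := by positivity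
  have h3 : 0 < b ^ 2 + x ^ 2 := by positivity
  rw [tF_eq hb, Real.norm_eq_abs, abs_div, abs_mul, abs_of_pos h1, abs_of_pos (mul_pos h2 h3)]
  unfold pk
  rw [one_pow, mul_one_div, div_le_div_iff₀ (by positivity) h2]
  have h4 : |x| ≤ b ^ 2 + x ^ 2 := by
    rw [← sq_abs x]; nlinarith [sq_nonneg (|x| - 1)]
  have := mul_le_mul_of_nonneg_left h4 (mul_pos h1 h2).le
  linarith

lemma tH_integrable {b : ℝ} (hb : 2 ≤ b) : Integrable (tH b) :=
  (pk_integrable (by linarith)).sub (pk_integrable one_pos)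

lemma im_ne {w : ℂ} (hw : 0 ≤ w.im) {b : ℝ} (hb : 0 < b) : w + b * I ≠ 0 := by
  intro h
  have := congrArg Complex.im h
  simp at this
  linarith

lemma norm_le_add {w : ℂ} (hw : 0 ≤ w.im) {b : ℝ} (hb : 0 < b) : ‖w‖ ≤ ‖w + b * I‖ := by
  rw [← sq_le_sq₀ (norm_nonneg _) (norm_nonneg _), ← Complex.normSq_eq_norm_sq, ← Complex.normSq_eq_norm_sq,
    Complex.normSq_apply, Complex.normSq_apply]
  simp
  nlinarith [mul_nonneg hw hb.le]

lemma tG_norm {b : ℝ} (hb : 2 ≤ b) {w : ℂ} (hw : 0 ≤ w.im) (h0 : 0 < ‖w‖) : ‖tG b w‖ ≤ (b - 1) / ‖w‖ ^ 2 := by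
  have hb0 : 0 < b := by linarith
  have e1 := im_ne hw one_pos
  have e2 := im_ne hw hb0
  have n1 := norm_le_add hw one_pos
  have n2 := norm_le_add hw hb0
  simp only [Complex.ofReal_one, one_mul] at e1 n1
  have e : tG b w = ((b - 1 : ℝ) : ℂ) * I / ((w + I) * (w + b * I)) := by
    unfold tG
    rw [div_sub_div _ _ e1 e2]
    push_cast
    ring
  rw [e, norm_div, norm_mul, norm_mul, norm_I, Complex.norm_real, Real.norm_of_nonneg (by linarith), mul_one, sq]
  gcongr
  linarith

lemma tG_diff {b : ℝ} (hb : 2 ≤ b) : DifferentiableOn ℂ (tG b) {w | 0 ≤ w.im} := by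
  intro w hw
  have e1 := im_ne hw one_pos
  simp only [Complex.ofReal_one, one_mul] at e1
  have e2 := im_ne hw (show 0 < b by linarith)
  unfold tG
  refine DifferentiableAt.differentiableWithinAt ?_
  have d1 : DifferentiableAt ℂ (fun w : ℂ => 1 / (w + I)) w :=
    (differentiableAt_const _).div (differentiableAt_id.add_const I) e1
  have d2 : DifferentiableAt ℂ (fun w : ℂ => 1 / (w + b * I)) w :=
    (differentiableAt_const _).div (differentiableAt_id.add_const _) e2
  exact d1.sub d2

lemma inv_ker {b : ℝ} (hb : 0 < b) (t : ℝ) : 1 / ((t : ℂ) + b * I) = qk b t - I * pk b t := by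
  have e := im_ne (w := (t : ℂ)) (by simp) hb
  have h : (b : ℂ) ^ 2 + (t : ℂ) ^ 2 ≠ 0 := by
    have : 0 < b ^ 2 + t ^ 2 := by positivity
    exact_mod_cast this.ne'
  unfold qk pk
  push_cast
  field_simp
  linear_combination (b : ℂ) ^ 2 * I_sq

lemma tG_real {b : ℝ} (hb : 2 ≤ b) (t : ℝ) : tG b t = tF b t + I * tH b t := by
  unfold tG tF tH
  have h1 := inv_ker one_pos t
  simp only [Complex.ofReal_one, one_mul] at h1
  rw [h1, inv_ker (by linarith)]
  push_cast; ring

lemma conj_ker (x : ℝ) {y : ℝ} (hy : 0 < y) (t : ℝ) :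
    I / (((x : ℂ) - y * I) - t) = I * qk y (x - t) - pk y (x - t) := by
  have h := inv_ker hy (t - x)
  have e : ((x : ℂ) - y * I) - t = - (((t - x : ℝ) : ℂ) + y * I) := by push_cast; ring
  rw [e, div_neg, ← mul_one_div, h]
  unfold qk pk
  have e2 : (t - x) ^ 2 = (x - t) ^ 2 := by ring
  rw [e2]
  push_cast
  ring_nf
  simp only [I_sq]
  ring

lemma pk_mul_int {g : ℝ → ℝ} (hg : Integrable g) (x : ℝ) {y : ℝ} (hy : 0 < y) :
    Integrable (fun t => pk y (x - t) * g t) :=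
  hg.bdd_mul (c := y⁻¹) ((pk_meas y).comp (measurable_const.sub measurable_id)).aestronglyMeasurable
    (ae_of_all _ fun t => by
      rw [Real.norm_eq_abs]
      show |pk y (x - t)| ≤ _
      rw [abs_of_nonneg (pk_nonneg hy _)]; exact pk_le_inv hy _)

lemma qk_mul_int {g : ℝ → ℝ} (hg : Integrable g) (x : ℝ) {y : ℝ} (hy : 0 < y) :
    Integrable (fun t => qk y (x - t) * g t) :=
  hg.bdd_mul (c := y⁻¹) ((qk_meas y).comp (measurable_const.sub measurable_id)).aestronglyMeasurable
    (ae_of_all _ fun t => qk_bdd hy (x - t))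

lemma test_key {b : ℝ} (hb : 2 ≤ b) (x y : ℝ) (hy : 0 < y) :
    ∫ t, qk y (x - t) * tF b t = ∫ t, pk y (x - t) * tH b t := by
  have hF := tF_integrable hb
  have hH := tH_integrable hb
  have hne : ∀ w : ℂ, 0 ≤ w.im → y ≤ ‖((x : ℂ) - y * I) - w‖ := by
    intro w hw
    refine le_trans ?_ (Complex.abs_im_le_norm _)
    simp
    rw [abs_of_nonpos (by linarith)]
    linarith
  have hD : ∀ t : ℝ, tG b t * (I / (((x : ℂ) - y * I) - t)) =
      ((-(pk y (x - t) * tF b t) - qk y (x - t) * tH b t : ℝ) : ℂ) +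
        ((qk y (x - t) * tF b t - pk y (x - t) * tH b t : ℝ) : ℂ) * I := by
    intro t
    rw [tG_real hb, conj_ker x hy]
    push_cast
    ring_nf
    simp only [I_sq]
    ring
  have hi1 : Integrable (fun t => qk y (x - t) * tF b t - pk y (x - t) * tH b t) :=
    (qk_mul_int hF x hy).sub (pk_mul_int hH x hy)
  have hi2 : Integrable (fun t => -(pk y (x - t) * tF b t) - qk y (x - t) * tH b t) :=
    (pk_mul_int hF x hy).neg.sub (qk_mul_int hH x hy)
  have hi : Integrable (fun t : ℝ => tG b t * (I / (((x : ℂ) - y * I) - t))) := by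
    simp_rw [hD]
    exact (toC hi2).add ((toC hi1).mul_const I)
  have h0 := contour' (D := fun w => tG b w * (I / (((x : ℂ) - y * I) - w))) (by
      refine (tG_diff hb).mul ?_
      intro w hw
      refine DifferentiableAt.differentiableWithinAt ?_
      exact (differentiableAt_const _).div (by fun_prop) (norm_pos_iff.1 (hy.trans_le (hne w hw))))
    ((b - 1) * y⁻¹) 1 (by
      intro w hw h1
      have h2 := tG_norm hb hw (by linarith)
      rw [norm_mul, norm_div, norm_I, mul_div_right_comm, one_div]
      exact mul_le_mul h2 (inv_anti₀ hy (hne w hw)) (by positivity) (by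
        have : 0 ≤ b - 1 := by linarith
        positivity)) hi
  have h1 := congrArg Complex.im h0
  simp only [hD] at h1
  rw [integral_add (toC hi2) ((toC hi1).mul_const I), integral_mul_const, integral_complex_ofReal, integral_complex_ofReal] at h1
  simp at h1
  rw [integral_sub (qk_mul_int hF x hy) (pk_mul_int hH x hy)] at h1
  linarith

lemma test_hilbert {b : ℝ} (hb : 2 ≤ b) :
    hilbertT (fun t => (tF b t : ℂ)) =ᵐ[volume] fun t => (tH b t : ℂ) := by
  refine hilbert_of_qk_eq_pk (toC (tF_integrable hb)) (toC (tH_integrable hb)) fun x y hy => ?_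
  have h := congrArg (fun r : ℝ => (r : ℂ)) (test_key hb x y hy)
  simp only [← integral_complex_ofReal] at h
  simp only [real_smul]
  push_cast at h
  exact h

lemma tH_norm {b : ℝ} (hb : 2 ≤ b) : ∫ t, ‖(tH b t : ℂ)‖ ≤ 2 * Real.pi := by
  have hb0 : 0 < b := by linarith
  calc ∫ t, ‖(tH b t : ℂ)‖ ≤ ∫ t, (pk b t + pk 1 t) := by
        refine integral_mono (toC (tH_integrable hb)).norm ((pk_integrable hb0).add (pk_integrable one_pos)) fun t => ?_
        have h1 := pk_nonneg hb0 t
        have h2 := pk_nonneg one_pos t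
        simp only [Complex.norm_real, Real.norm_eq_abs]
        unfold tH
        rw [abs_le]; constructor <;> linarith
    _ = 2 * Real.pi := by
        rw [integral_add (pk_integrable hb0) (pk_integrable one_pos), pk_integral hb0, pk_integral one_pos]; ring

lemma test_mem {b : ℝ} (hb : 2 ≤ b) : MemH1 (fun t => (tF b t : ℂ)) :=
  ⟨toC (tF_integrable hb), (toC (tH_integrable hb)).congr (test_hilbert hb).symm⟩

lemma test_norm {b : ℝ} (hb : 2 ≤ b) :
    h1Norm (fun t => (tF b t : ℂ)) ≤ ENNReal.ofReal ((∫ t, |tF b t|) + 2 * Real.pi) := by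
  unfold h1Norm
  rw [eLpNorm_congr_ae (test_hilbert hb), eLp_one (toC (tF_integrable hb)), eLp_one (toC (tH_integrable hb)),
    ENNReal.ofReal_add (integral_nonneg fun _ => abs_nonneg _) (by positivity)]
  refine add_le_add (le_of_eq ?_) (ENNReal.ofReal_le_ofReal (tH_norm hb))
  simp only [Complex.norm_real, Real.norm_eq_abs]

/-- sign -/
noncomputable def sg (x : ℝ) : ℝ := if 0 ≤ x then 1 else -1

lemma sg_meas : Measurable sg := Measurable.ite measurableSet_Ici measurable_const measurable_const

lemma sg_abs (x : ℝ) : |sg x| ≤ 1 := by unfold sg; split_ifs <;> simp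

lemma sg_mul {t : ℝ} (ht : 0 < t) (s : ℝ) : sg (t * s) = sg s := by
  unfold sg; simp [mul_nonneg_iff_of_pos_left ht]

lemma sg_tF {b : ℝ} (hb : 2 ≤ b) (s : ℝ) : sg s * tF b s = |tF b s| := by
  have h1 : 0 < b ^ 2 - 1 := by nlinarith
  have h3 : 0 < (1 + s ^ 2) * (b ^ 2 + s ^ 2) := by positivity
  rw [tF_eq hb, abs_div, abs_mul, abs_of_pos h1, abs_of_pos h3]
  unfold sg
  split_ifs with h
  · rw [abs_of_nonneg h]; ring
  · rw [abs_of_neg (not_le.1 h)]; ring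

lemma test_lower {φ : ℝ → ℝ} (hint : IntegrableOn φ (Ioi 0)) {b : ℝ} (hb : 2 ≤ b) :
    (∫ t in Ioi 0, φ t) * (∫ t, |tF b t|) ≤ ∫ x, ‖hausdorffR φ (fun t => (tF b t : ℂ)) x‖ := by
  have hd := haus_dual hint (toC (tF_integrable hb)) sg_meas 1 sg_abs
  have e : ∫ t in Ioi 0, φ t • ∫ s, sg (t * s) • (tF b s : ℂ) =
      (((∫ t in Ioi 0, φ t) * (∫ t, |tF b t|) : ℝ) : ℂ) := by
    rw [← integral_mul_const, ← integral_complex_ofReal]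
    refine setIntegral_congr_fun measurableSet_Ioi fun t ht => ?_
    have ht : (0:ℝ) < t := ht
    simp only [sg_mul ht, real_smul]
    push_cast
    rw [← integral_complex_ofReal]
    congr 2; ext s
    rw [← sg_tF hb]; push_cast; rfl
  have h := norm_integral_le_integral_norm (μ := volume) (fun x => sg x • hausdorffR φ (fun t => (tF b t : ℂ)) x)
  rw [hd] at h
  erw [e] at h
  rw [Complex.norm_real] at h
  refine (le_abs_self _).trans (h.trans ?_)
  have hi := haus_L1 hint (f := fun t => (tF b t : ℂ)) (toC (tF_integrable hb))
  refine integral_mono_of_nonneg (ae_of_all _ fun _ => norm_nonneg _) hi.norm (ae_of_all _ fun x => ?_)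
  simp only [norm_smul]
  exact mul_le_of_le_one_left (norm_nonneg _) (sg_abs x)

lemma test_large {b : ℝ} (hb : 2 ≤ b) : 3 / 16 * Real.log b ≤ ∫ t, |tF b t| := by
  have hi := (tF_integrable hb).abs
  have hb1 : (1:ℝ) ≤ b := by linarith
  calc 3 / 16 * Real.log b = ∫ x in (1:ℝ)..b, 3 / 16 * (1 / x) := by
        rw [intervalIntegral.integral_const_mul, integral_one_div_of_pos one_pos (by linarith), div_one]
    _ ≤ ∫ x in (1:ℝ)..b, |tF b x| := by
        refine intervalIntegral.integral_mono_on hb1 ?_ hi.intervalIntegrable ?_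
        · refine (intervalIntegral.intervalIntegrable_one_div (fun x hx => ?_) (by fun_prop)).const_mul _
          rw [uIcc_of_le hb1] at hx
          linarith [hx.1]
        · intro x hx
          obtain ⟨h1, h2⟩ := hx
          refine le_trans ?_ (le_abs_self _)
          rw [tF_eq hb, mul_one_div, div_le_div_iff₀ (by linarith) (by positivity)]
          have a1 : 1 + x ^ 2 ≤ 2 * x ^ 2 := by nlinarith
          have a2 : b ^ 2 + x ^ 2 ≤ 2 * b ^ 2 := by nlinarith
          have a3 : 3 / 4 * b ^ 2 ≤ b ^ 2 - 1 := by nlinarith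
          have a4 := mul_le_mul a1 a2 (by positivity) (by positivity)
          have a5 := mul_le_mul_of_nonneg_left a3 (sq_nonneg x)
          nlinarith
    _ ≤ ∫ t, |tF b t| := by
        rw [intervalIntegral.integral_of_le hb1]
        exact setIntegral_le_integral hi (ae_of_all _ fun _ => abs_nonneg _)

lemma test_unbounded (M : ℝ) : ∃ b : ℝ, 2 ≤ b ∧ M ≤ ∫ t, |tF b t| := by
  have hb : (2:ℝ) ≤ Real.exp (16 / 3 * |M| + 1) := by
    have := Real.add_one_le_exp (16 / 3 * |M| + 1)
    have := abs_nonneg M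
    linarith
  refine ⟨_, hb, le_trans ?_ (test_large hb)⟩
  rw [Real.log_exp]
  have := le_abs_self M
  linarith

theorem haus_lower {φ : ℝ → ℝ} (hint : IntegrableOn φ (Ioi 0)) {c : ℝ} (hc : 0 ≤ c)
    (H : ∀ f : ℝ → ℂ, MemH1 f → h1Norm (hausdorffR φ f) ≤ ENNReal.ofReal c * h1Norm f) :
    ∫ t in Ioi 0, φ t ≤ c := by
  by_contra! hlt
  have key : ∀ b : ℝ, 2 ≤ b → (∫ t in Ioi 0, φ t) * (∫ t, |tF b t|) ≤ c * ((∫ t, |tF b t|) + 2 * Real.pi) := by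
    intro b hb
    have hN : 0 ≤ ∫ t, |tF b t| := integral_nonneg fun _ => abs_nonneg _
    have h1 := H _ (test_mem hb)
    have h2 : ENNReal.ofReal ((∫ t in Ioi 0, φ t) * (∫ t, |tF b t|)) ≤
        ENNReal.ofReal (c * ((∫ t, |tF b t|) + 2 * Real.pi)) := by
      rw [ENNReal.ofReal_mul hc]
      calc _ ≤ ENNReal.ofReal (∫ x, ‖hausdorffR φ (fun t => (tF b t : ℂ)) x‖) :=
            ENNReal.ofReal_le_ofReal (test_lower hint hb)
        _ = eLpNorm (hausdorffR φ (fun t => (tF b t : ℂ))) 1 volume := 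
            (eLp_one (haus_L1 hint (f := fun t => (tF b t : ℂ)) (toC (tF_integrable hb)))).symm
        _ ≤ h1Norm (hausdorffR φ (fun t => (tF b t : ℂ))) := le_self_add
        _ ≤ _ := h1.trans (mul_le_mul_right (test_norm hb) _)
    exact (ENNReal.ofReal_le_ofReal_iff (by positivity)).1 h2
  obtain ⟨b, hb, hM⟩ := test_unbounded ((c * (2 * Real.pi) + 1) / ((∫ t in Ioi 0, φ t) - c))
  have h := key b hb
  rw [div_le_iff₀ (by linarith)] at hM
  linarith

theorem hausdorff_H1_bounded_of_support (φ : ℝ → ℝ) (hφ : ∀ t, 0 ≤ φ t)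
    (hloc : LocallyIntegrableOn φ (Set.Ioi 0))
    (hsupp : ∀ t : ℝ, 1 < t → φ t = 0)
    (hint : IntegrableOn φ (Set.Ioi 0)) :
    (∃ C : ℝ≥0∞, C < ⊤ ∧ ∀ f : ℝ → ℂ, MemH1 f →
      MemH1 (hausdorffR φ f) ∧ h1Norm (hausdorffR φ f) ≤ C * h1Norm f) ∧
    ENNReal.ofReal (∫ t in Set.Ioc (0 : ℝ) 1, φ t) ≤
      sInf {C : ℝ≥0∞ | ∀ f : ℝ → ℂ, MemH1 f →
        h1Norm (hausdorffR φ f) ≤ C * h1Norm f} ∧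
    sInf {C : ℝ≥0∞ | ∀ f : ℝ → ℂ, MemH1 f →
        h1Norm (hausdorffR φ f) ≤ C * h1Norm f} < ⊤ := by
  refine ⟨⟨_, ENNReal.ofReal_lt_top, fun f hf => haus_bounded hφ hint hf⟩, ?_, ?_⟩
  · refine le_sInf fun C hC => ?_
    by_cases hT : C = ⊤
    · rw [hT]; exact le_top
    · rw [← ENNReal.ofReal_toReal hT] at hC ⊢
      refine ENNReal.ofReal_le_ofReal (le_trans ?_ (haus_lower hint ENNReal.toReal_nonneg hC))
      exact setIntegral_mono_set hint (ae_of_all _ hφ) (LE.le.eventuallyLE Ioc_subset_Ioi_self)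
  · exact lt_of_le_of_lt (sInf_le fun f hf => (haus_bounded hφ hint hf).2) ENNReal.ofReal_lt_top
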